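/- arXiv:0905.3839 — 2 statements merged into one kernel-verified Lean document; each statement's English description precedes it below -/
import Mathlib

section
/- Sharp strong-type bound for the Riesz potential in the full range: Let 0 < α < n, 1 < p < n/α, and define q by 1/q = 1/p − α/n. Then there is a constant c = c(n,α,p) such that for every weight w ∈ A_{p,q} and every measurable f, ‖w·I_α f‖_{L^{q}(ℝⁿ)} ≤ c [w]_{A_{p,q}}^{(1−α/n)·max{1, p′/q}} ‖w·f‖_{L^{p}(ℝⁿ)}. -/
open MeasureTheory ENNReal Set

noncomputable section

/-- Euclidean space `ℝⁿ`. -/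
abbrev Euc (n : ℕ) := EuclideanSpace ℝ (Fin n)

variable {n : ℕ}

/-- The axis-parallel closed cube with lower corner `a` and side length `h`. -/
def Cube (a : Euc n) (h : ℝ) : Set (Euc n) :=
  {x | ∀ i, a i ≤ x i ∧ x i ≤ a i + h}

/-- The weighted measure `u(E) = ∫_E u dx` of a set. -/
def wMeas (u : Euc n → ℝ) (E : Set (Euc n)) : ℝ≥0∞ :=
  ∫⁻ x in E, ENNReal.ofReal (u x)

/-- The dual exponent `p' = p/(p-1)`. -/
def dualExp (p : ℝ) : ℝ := p / (p - 1)

/-- The `A_{p,q}` constant of a weight `w` (with the `A_{1,q}` convention when `p = 1`). -/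
def Apq (p q : ℝ) (w : Euc n → ℝ) : ℝ≥0∞ :=
  ⨆ (a : Euc n) (h : ℝ) (_ : 0 < h),
    ((volume (Cube a h))⁻¹ * ∫⁻ x in Cube a h, ENNReal.ofReal (w x) ^ q) *
      (if p = 1 then
        (essSup (fun x => (ENNReal.ofReal (w x))⁻¹) (volume.restrict (Cube a h))) ^ q
      else
        ((volume (Cube a h))⁻¹ * ∫⁻ x in Cube a h,
            ENNReal.ofReal (w x) ^ (-(dualExp p))) ^ (q / dualExp p))

/-- The weighted Lebesgue norm `‖w f‖_{L^p(ℝⁿ)}`. -/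
def wLp (w f : Euc n → ℝ) (p : ℝ) : ℝ≥0∞ :=
  (∫⁻ x, (ENNReal.ofReal (w x) * ENNReal.ofReal |f x|) ^ p) ^ (1 / p)

/-- The weighted Lebesgue norm `‖w g‖_{L^q(ℝⁿ)}` of an `ℝ≥0∞`-valued function. -/
def wLpE (w : Euc n → ℝ) (g : Euc n → ℝ≥0∞) (q : ℝ) : ℝ≥0∞ :=
  (∫⁻ x, (ENNReal.ofReal (w x) * g x) ^ q) ^ (1 / q)

/-- The weak norm `‖g‖_{L^{q,∞}(u)} = sup_{λ>0} λ u({|g|>λ})^{1/q}`. -/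
def weakLp (u : Euc n → ℝ) (g : Euc n → ℝ) (q : ℝ) : ℝ≥0∞ :=
  ⨆ (t : ℝ) (_ : 0 < t), ENNReal.ofReal t * wMeas u {x | t < |g x|} ^ (1 / q)

/-- The weak norm of an `ℝ≥0∞`-valued function. -/
def weakLpE (u : Euc n → ℝ) (g : Euc n → ℝ≥0∞) (q : ℝ) : ℝ≥0∞ :=
  ⨆ (t : ℝ) (_ : 0 < t), ENNReal.ofReal t * wMeas u {x | ENNReal.ofReal t < g x} ^ (1 / q)

/-- The fractional integral (Riesz potential) `I_α f(x) = ∫ |f(y)| |x-y|^{α-n} dy`. -/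
def riesz (α : ℝ) (f : Euc n → ℝ) (x : Euc n) : ℝ≥0∞ :=
  ∫⁻ y, ENNReal.ofReal |f y| * ENNReal.ofReal (‖x - y‖ ^ (α - (n : ℝ)))

/-- The fractional maximal operator `M_α f(x) = sup_{Q ∋ x} |Q|^{α/n-1} ∫_Q |f|`. -/
def fracMax (α : ℝ) (f : Euc n → ℝ) (x : Euc n) : ℝ≥0∞ :=
  ⨆ (a : Euc n) (h : ℝ) (_ : 0 < h) (_ : x ∈ Cube a h),
    volume (Cube a h) ^ (α / (n : ℝ) - 1) * ∫⁻ y in Cube a h, ENNReal.ofReal |f y|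


open scoped Classical in
/-- pairwise nested or disjoint -/
def Lam {X : Type*} (Qs : Finset (Set X)) : Prop :=
  ∀ P ∈ Qs, ∀ Q ∈ Qs, P ⊆ Q ∨ Q ⊆ P ∨ Disjoint P Q

theorem Lam.mono {X : Type*} {Qs Ps : Finset (Set X)} (h : Lam Qs) (hs : Ps ⊆ Qs) : Lam Ps :=
  fun P hP Q hQ => h P (hs hP) Q (hs hQ)

open scoped Classical in
theorem lam_induct {X : Type*} {motive : Finset (Set X) → Prop} (h0 : motive ∅)
    (h1 : ∀ (Qs : Finset (Set X)) (Q0 : Set X), Q0 ∉ Qs → (∀ Q ∈ Qs, ¬ Q ⊆ Q0) → motive Qs →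
      motive (insert Q0 Qs)) (Qs : Finset (Set X)) : motive Qs := by
  induction Qs using Finset.strongInduction with
  | H s ih =>
    rcases s.eq_empty_or_nonempty with rfl | hne
    · exact h0
    · obtain ⟨Q0, hm⟩ := s.exists_minimal hne
      have hQ0 : Q0 ∈ s := hm.1
      have := h1 (s.erase Q0) Q0 (by simp) (by
        intro Q hQ hsub
        rw [Finset.mem_erase] at hQ
        exact hQ.1 (Set.Subset.antisymm hsub (hm.2 hQ.2 hsub))) (ih _ (Finset.erase_ssubset hQ0))
      rwa [Finset.insert_erase hQ0] at this

/-- the sets of a laminar family containing a nonempty set have a least element -/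
theorem exists_least {X : Type*} {Qs : Finset (Set X)} (h : Lam Qs) (Q : Set X) (hQ : Q.Nonempty)
    (hex : ∃ F ∈ Qs, Q ⊆ F) : ∃ F ∈ Qs, Q ⊆ F ∧ ∀ F' ∈ Qs, Q ⊆ F' → F ⊆ F' := by
  classical
  obtain ⟨F, hF⟩ := (Qs.filter (fun F => Q ⊆ F)).exists_minimal (by
    obtain ⟨F, hF, h⟩ := hex
    exact ⟨F, by simp [hF, h]⟩)
  have hF1 := hF.1
  simp only [Finset.mem_filter] at hF1
  refine ⟨F, hF1.1, hF1.2, fun F' hF' hQF' => ?_⟩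
  rcases h F hF1.1 F' hF' with h | h | h
  · exact h
  · exact hF.2 (by simp [hF', hQF']) h
  · obtain ⟨x, hx⟩ := hQ
    exact absurd (hQF' hx) (Set.disjoint_left.1 h (hF1.2 hx))

open scoped Classical in
theorem stopping {X : Type*} (A : ℝ≥0∞) (hA : 1 ≤ A) (φ : Set X → ℝ≥0∞) (Qs : Finset (Set X)) :
    Lam Qs → (∀ Q ∈ Qs, Q.Nonempty) → ∃ Fs ⊆ Qs,
      (∀ Q ∈ Qs, ∃ F ∈ Fs, Q ⊆ F ∧ φ Q ≤ A * φ F ∧ ∀ F' ∈ Fs, Q ⊆ F' → F ⊆ F') ∧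
      (∀ F ∈ Fs, ∀ F' ∈ Fs, F' ⊂ F → A * φ F < φ F') := by
  induction Qs using lam_induct with
  | h0 => intro _ _; exact ⟨∅, by simp, by simp, by simp⟩
  | h1 Qs Q0 hQ0 hmin ih =>
    intro hL hne
    obtain ⟨Fs, hFs, h1, h2⟩ := ih (hL.mono (Finset.subset_insert _ _))
      (fun Q hQ => hne Q (Finset.mem_insert_of_mem hQ))
    have hLF : Lam Fs := hL.mono (hFs.trans (Finset.subset_insert _ _))
    by_cases hc : ∃ F ∈ Fs, Q0 ⊆ F ∧ φ Q0 ≤ A * φ F ∧ ∀ F' ∈ Fs, Q0 ⊆ F' → F ⊆ F'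
    · refine ⟨Fs, hFs.trans (Finset.subset_insert _ _), ?_, h2⟩
      intro Q hQ
      rcases Finset.mem_insert.1 hQ with rfl | hQ
      · exact hc
      · exact h1 Q hQ
    · refine ⟨insert Q0 Fs, Finset.insert_subset_insert _ hFs, ?_, ?_⟩
      · intro Q hQ
        rcases Finset.mem_insert.1 hQ with rfl | hQ2
        · refine ⟨Q, by simp, Subset.rfl, le_mul_of_one_le_left (by simp) hA, fun F' _ h => h⟩
        · obtain ⟨F, hF, h3, h4, h5⟩ := h1 Q hQ2
          refine ⟨F, by simp [hF], h3, h4, ?_⟩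
          intro F' hF' hs
          rcases Finset.mem_insert.1 hF' with rfl | hF'
          · exact absurd hs (hmin Q hQ2)
          · exact h5 F' hF' hs
      · intro F hF F' hF' hss
        rcases Finset.mem_insert.1 hF' with rfl | hF2'
        · rcases Finset.mem_insert.1 hF with rfl | hF
          · exact absurd hss (ssubset_irrefl _)
          · obtain ⟨G, hG, hG1, hG2⟩ := exists_least hLF F' (hne F' (by simp)) ⟨F, hF, hss.1⟩
            have h6 : A * φ G < φ F' := by
              by_contra hcon
              exact hc ⟨G, hG, hG1, not_lt.1 hcon, hG2⟩
            rcases eq_or_ne G F with rfl | hne'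
            · exact h6
            · have h7 := h2 F hF G hG (lt_of_le_of_ne (hG2 F hF hss.1) hne')
              exact (h7.trans_le (le_mul_of_one_le_left (by simp) hA)).trans h6
        · rcases Finset.mem_insert.1 hF with rfl | hF
          · exact absurd hss.1 (hmin F' (hFs hF2'))
          · exact h2 F hF F' hF2' hss

theorem geo_sum {ι : Type*} (θ C : ℝ≥0∞) (hC : 1 + θ * C ≤ C) (a : ι → ℝ≥0∞) (T : Finset ι) :
    ∀ M : ℝ≥0∞, (∀ i ∈ T, a i ≤ M) →
    (∀ i ∈ T, ∀ j ∈ T, i ≠ j → a i ≤ θ * a j ∨ a j ≤ θ * a i) → ∑ i ∈ T, a i ≤ C * M := by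
  classical
  induction T using Finset.induction_on_max_value a with
  | empty => simp
  | insert i s hi hmax ih =>
    intro M hM hsep
    rw [Finset.sum_insert hi]
    have h1 : ∑ j ∈ s, a j ≤ C * (θ * a i) := by
      refine ih _ ?_ ?_
      · intro j hj
        rcases hsep j (by simp [hj]) i (by simp) (by rintro rfl; exact hi hj) with h | h
        · exact h
        · calc a j ≤ a i := hmax j hj
            _ ≤ θ * a j := h
            _ ≤ θ * a i := by gcongr; exact hmax j hj
      · intro j hj k hk
        exact hsep j (by simp [hj]) k (by simp [hk])
    calc a i + ∑ j ∈ s, a j ≤ a i + C * (θ * a i) := by gcongr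
      _ = (1 + θ * C) * a i := by ring
      _ ≤ C * M := by gcongr; exact hM i (by simp)

/-- geometric constant -/
def Geo (θ : ℝ≥0∞) : ℝ≥0∞ := (1 - θ)⁻¹

theorem Geo_spec {θ : ℝ≥0∞} (h : θ < 1) : 1 + θ * Geo θ ≤ Geo θ := by
  have h0 : (1 - θ) ≠ 0 := (tsub_pos_of_lt h).ne'
  have h1 : (1 - θ) ≠ ⊤ := (tsub_le_self.trans_lt one_lt_top).ne
  unfold Geo
  have : (1:ℝ≥0∞) = (1 - θ) * (1 - θ)⁻¹ := (ENNReal.mul_inv_cancel h0 h1).symm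
  calc 1 + θ * (1 - θ)⁻¹ = (1 - θ) * (1 - θ)⁻¹ + θ * (1 - θ)⁻¹ := by rw [← this]
    _ = ((1 - θ) + θ) * (1 - θ)⁻¹ := by ring
    _ = (1 - θ)⁻¹ := by rw [tsub_add_cancel_of_le h.le, one_mul]
    _ ≤ _ := le_rfl

theorem Geo_ne_top {θ : ℝ≥0∞} (h : θ < 1) : Geo θ ≠ ⊤ := by
  unfold Geo
  simp [tsub_eq_zero_iff_le, h]

theorem two_rpow_neg_lt {r : ℝ} (h : 0 < r) : (2 : ℝ≥0∞) ^ (-r) < 1 := by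
  rw [ENNReal.rpow_neg]
  apply ENNReal.inv_lt_one.2
  exact ENNReal.one_lt_rpow (by norm_num) h

/-- tower sum for a stopping family -/
theorem tower_sum {X : Type*} {Fs : Finset (Set X)} (hL : Lam Fs) (φ : Set X → ℝ≥0∞)
    (hst : ∀ F ∈ Fs, ∀ F' ∈ Fs, F' ⊂ F → 2 * φ F < φ F') {r : ℝ} (hr : 0 < r) (x : X)
    (T : Finset (Set X)) (hT : T ⊆ Fs) (hx : ∀ F ∈ T, x ∈ F) (M : ℝ≥0∞) (hM : ∀ F ∈ T, φ F ≤ M) :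
    ∑ F ∈ T, φ F ^ r ≤ Geo (2 ^ (-r)) * M ^ r := by
  refine geo_sum _ _ (Geo_spec (two_rpow_neg_lt hr)) _ T _ ?_ ?_
  · intro F hF
    exact ENNReal.rpow_le_rpow (hM F hF) hr.le
  · have key : ∀ F ∈ T, ∀ F' ∈ T, F ≠ F' → F' ⊆ F → φ F ^ r ≤ 2 ^ (-r) * φ F' ^ r := by
      intro F hF F' hF' hne hs
      have := (hst F (hT hF) F' (hT hF') (lt_of_le_of_ne hs hne.symm)).le
      have h2 : φ F ≤ 2⁻¹ * φ F' := by
        calc φ F = 2⁻¹ * (2 * φ F) := by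
              rw [← mul_assoc, ENNReal.inv_mul_cancel (by norm_num) (by norm_num), one_mul]
          _ ≤ _ := by gcongr
      calc φ F ^ r ≤ (2⁻¹ * φ F') ^ r := ENNReal.rpow_le_rpow h2 hr.le
        _ = _ := by
          rw [ENNReal.mul_rpow_of_nonneg _ _ hr.le, ENNReal.inv_rpow, ENNReal.rpow_neg]
    intro F hF F' hF' hne
    rcases hL F (hT hF) F' (hT hF') with h | h | h
    · right; exact key F' hF' F hF hne.symm h
    · left; exact key F hF F' hF' hne h
    · exact absurd (hx F' hF') (Set.disjoint_left.1 h (hx F hF))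

open scoped Classical in
/-- measure comparison on unions of laminar families -/
theorem lam_union {X : Type*} [MeasurableSpace X] (μ σ : Measure X) (c : ℝ≥0∞)
    (Qs : Finset (Set X)) :
    Lam Qs → (∀ Q ∈ Qs, MeasurableSet Q) → (∀ Q ∈ Qs, μ Q ≤ c * σ Q) →
    μ (⋃ Q ∈ Qs, Q) ≤ c * σ (⋃ Q ∈ Qs, Q) := by
  induction Qs using lam_induct with
  | h0 => simp
  | h1 Qs Q0 hQ0 hmin ih =>
    intro hL hm hc
    have ih' := ih (hL.mono (Finset.subset_insert _ _))
      (fun Q hQ => hm Q (Finset.mem_insert_of_mem hQ))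
      (fun Q hQ => hc Q (Finset.mem_insert_of_mem hQ))
    rw [Finset.set_biUnion_insert]
    by_cases h : ∃ Q ∈ Qs, Q0 ⊆ Q
    · obtain ⟨Q, hQ, hs⟩ := h
      have : Q0 ⊆ ⋃ Q ∈ Qs, Q := hs.trans (Set.subset_biUnion_of_mem (u := fun Q => Q) hQ)
      rwa [Set.union_eq_self_of_subset_left this]
    · push Not at h
      have hd : Disjoint Q0 (⋃ Q ∈ Qs, Q) := by
        rw [Set.disjoint_iUnion₂_right]
        intro Q hQ
        rcases hL Q0 (by simp) Q (by simp [hQ]) with h' | h' | h'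
        · exact absurd h' (h Q hQ)
        · exact absurd h' (hmin Q hQ)
        · exact h'
      have hmU : MeasurableSet (⋃ Q ∈ Qs, Q) :=
        Finset.measurableSet_biUnion _ (fun Q hQ => hm Q (by simp [hQ]))
      rw [measure_union hd hmU, measure_union hd hmU, mul_add]
      exact add_le_add (hc Q0 (by simp)) ih'

def Erem {X : Type*} (Fs : Finset (Set X)) (F : Set X) : Set X :=
  F \ ⋃ F' ∈ {F' | F' ∈ Fs ∧ F' ⊂ F}, F'

theorem mem_Erem {X : Type*} {Fs : Finset (Set X)} {F : Set X} {x : X} :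
    x ∈ Erem Fs F ↔ x ∈ F ∧ ∀ F' ∈ Fs, F' ⊂ F → x ∉ F' := by
  simp [Erem]

theorem Erem_disj {X : Type*} {Fs : Finset (Set X)} (hL : Lam Fs) :
    Set.PairwiseDisjoint (Fs : Set (Set X)) (Erem Fs) := by
  intro F hF G hG hne
  rw [Function.onFun, Set.disjoint_left]
  intro x hx hy
  rw [mem_Erem] at hx hy
  rcases hL F hF G hG with h | h | h
  · exact hy.2 F hF (lt_of_le_of_ne h hne) hx.1
  · exact hx.2 G hG (lt_of_le_of_ne h hne.symm) hy.1
  · exact Set.disjoint_left.1 h hx.1 hy.1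

theorem Erem_meas {X : Type*} [MeasurableSpace X] {Fs : Finset (Set X)}
    (hm : ∀ F ∈ Fs, MeasurableSet F) {F : Set X} (hF : F ∈ Fs) : MeasurableSet (Erem Fs F) := by
  unfold Erem
  refine (hm F hF).diff ?_
  refine MeasurableSet.biUnion ?_ (fun G hG => hm G hG.1)
  exact (Fs.finite_toSet.subset (fun G hG => hG.1)).countable

theorem Erem_subset {X : Type*} {Fs : Finset (Set X)} {F : Set X} : Erem Fs F ⊆ F :=
  sdiff_subset

/-- sums of a measure of remainder sets -/
theorem sum_Erem_le {X : Type*} [MeasurableSpace X] (μ : Measure X) {Fs Ts : Finset (Set X)}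
    (hL : Lam Fs) (hm : ∀ F ∈ Fs, MeasurableSet F) (hT : Ts ⊆ Fs) {R : Set X}
    (hR : ∀ F ∈ Ts, F ⊆ R) : ∑ F ∈ Ts, μ (Erem Fs F) ≤ μ R := by
  rw [← measure_biUnion_finset]
  · exact measure_mono (Set.iUnion₂_subset fun F hF => Erem_subset.trans (hR F hF))
  · exact (Erem_disj hL).subset (by exact_mod_cast hT)
  · exact fun F hF => Erem_meas hm (hT hF)

/-- sparse lemma: half of the measure is in the remainder set -/
theorem Erem_half {X : Type*} [MeasurableSpace X] (μ σ : Measure X) {Fs : Finset (Set X)}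
    (hL : Lam Fs) (hm : ∀ F ∈ Fs, MeasurableSet F) (hμ : ∀ F ∈ Fs, μ F ≠ 0 ∧ μ F ≠ ⊤)
    (hσ : ∀ F ∈ Fs, σ F ≠ 0 ∧ σ F ≠ ⊤)
    (hst : ∀ F ∈ Fs, ∀ F' ∈ Fs, F' ⊂ F → 2 * (σ F / μ F) < σ F' / μ F') {F : Set X} (hF : F ∈ Fs) :
    μ F ≤ 2 * μ (Erem Fs F) := by
  classical
  set U := ⋃ F' ∈ Fs.filter (fun F' => F' ⊂ F), F' with hU
  have h1 : μ U ≤ (μ F / σ F / 2) * σ U := by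
    refine lam_union μ σ _ _ (hL.mono (Finset.filter_subset _ _)) ?_ ?_
    · intro Q hQ; exact hm Q (Finset.mem_filter.1 hQ).1
    · intro Q hQ
      rw [Finset.mem_filter] at hQ
      have h2 := (hst F hF Q hQ.1 hQ.2).le
      obtain ⟨m0, m1⟩ := hμ F hF
      obtain ⟨s0, s1⟩ := hσ F hF
      obtain ⟨n0, n1⟩ := hμ Q hQ.1
      have h3 : 2 * (σ F / μ F) * μ Q ≤ σ Q := by
        calc _ ≤ σ Q / μ Q * μ Q := by gcongr
          _ = σ Q := ENNReal.div_mul_cancel n0 n1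
      have h4 : (μ F / σ F / 2) * (2 * (σ F / μ F)) = 1 := by
        simp only [div_eq_mul_inv]
        calc _ = (μ F * (μ F)⁻¹) * (σ F * (σ F)⁻¹) * (2 * 2⁻¹) := by ring
          _ = 1 := by
            rw [ENNReal.mul_inv_cancel m0 m1, ENNReal.mul_inv_cancel s0 s1,
              ENNReal.mul_inv_cancel (by norm_num) (by norm_num)]; simp
      calc μ Q = (μ F / σ F / 2) * (2 * (σ F / μ F)) * μ Q := by rw [h4, one_mul]
        _ = (μ F / σ F / 2) * (2 * (σ F / μ F) * μ Q) := by ring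
        _ ≤ _ := by gcongr
  have hUF : U ⊆ F := Set.iUnion₂_subset fun Q hQ => (Finset.mem_filter.1 hQ).2.1
  have h2 : μ U ≤ μ F / 2 := by
    calc μ U ≤ (μ F / σ F / 2) * σ F := h1.trans (by gcongr)
      _ = μ F * ((σ F)⁻¹ * σ F) / 2 := by simp only [div_eq_mul_inv]; ring
      _ = _ := by rw [ENNReal.inv_mul_cancel (hσ F hF).1 (hσ F hF).2, mul_one]
  have hE : F ⊆ Erem Fs F ∪ U := by
    intro x hx
    by_cases hxU : x ∈ U
    · right; exact hxU
    · left
      rw [mem_Erem]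
      refine ⟨hx, fun F' hF' hs hx' => hxU ?_⟩
      simp only [hU, Set.mem_iUnion]
      exact ⟨F', by simp [hF', hs], hx'⟩
  have h3 : μ F ≤ μ (Erem Fs F) + μ F / 2 :=
    (measure_mono hE).trans ((measure_union_le _ _).trans (by gcongr))
  have hfin : μ F / 2 ≠ ⊤ := ENNReal.div_ne_top (hμ F hF).2 (by norm_num)
  have h4 : μ F / 2 ≤ μ (Erem Fs F) := by
    have : μ F / 2 + μ F / 2 ≤ μ (Erem Fs F) + μ F / 2 := by rwa [ENNReal.add_halves]
    exact (ENNReal.add_le_add_iff_right hfin).1 this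
  calc μ F = 2 * (μ F / 2) := by rw [ENNReal.mul_div_cancel (by norm_num) (by norm_num)]
    _ ≤ _ := by gcongr

/-- abstract hypotheses -/
structure Hyp {X : Type*} [MeasurableSpace X] (μ σ u : Measure X) (a b : ℝ) (L D : ℝ≥0∞)
    (Qs : Finset (Set X)) : Prop where
  ha : 0 < a
  hb : 0 < b
  hab : a + b < 1
  lam : Lam Qs
  meas : ∀ Q ∈ Qs, MeasurableSet Q
  hμ : ∀ Q ∈ Qs, μ Q ≠ 0 ∧ μ Q ≠ ⊤
  hσ : ∀ Q ∈ Qs, σ Q ≠ 0 ∧ σ Q ≠ ⊤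
  hu : ∀ Q ∈ Qs, u Q ≠ 0 ∧ u Q ≠ ⊤
  apq : ∀ Q ∈ Qs, σ Q ^ a * u Q ^ b ≤ L * μ Q ^ (a + b)
  hold : ∀ E, MeasurableSet E → μ E ^ (a + b) ≤ σ E ^ a * u E ^ b
  tower : ∀ (x : X) (Ts : Finset (Set X)) (R : Set X), R ∈ Qs → Ts ⊆ Qs →
    (∀ Q ∈ Ts, x ∈ Q ∧ Q ⊆ R) → ∑ Q ∈ Ts, μ Q ^ (1 - a - b) ≤ D * μ R ^ (1 - a - b)

theorem Hyp.symm {X : Type*} [MeasurableSpace X] {μ σ u : Measure X} {a b : ℝ} {L D : ℝ≥0∞}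
    {Qs : Finset (Set X)} (H : Hyp μ σ u a b L D Qs) : Hyp μ u σ b a L D Qs where
  ha := H.hb
  hb := H.ha
  hab := by linarith [H.hab]
  lam := H.lam
  meas := H.meas
  hμ := H.hμ
  hσ := H.hu
  hu := H.hσ
  apq := by intro Q hQ; rw [mul_comm, add_comm]; exact H.apq Q hQ
  hold := by intro Q hQ; rw [mul_comm, add_comm]; exact H.hold Q hQ
  tower := by
    intro x Ts R hR hT h
    have e : 1 - b - a = 1 - a - b := by ring
    rw [e]
    exact H.tower x Ts R hR hT h

theorem Hyp.mono {X : Type*} [MeasurableSpace X] {μ σ u : Measure X} {a b : ℝ} {L D : ℝ≥0∞}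
    {Qs Ps : Finset (Set X)} (H : Hyp μ σ u a b L D Qs) (h : Ps ⊆ Qs) : Hyp μ σ u a b L D Ps where
  ha := H.ha
  hb := H.hb
  hab := H.hab
  lam := H.lam.mono h
  meas := fun Q hQ => H.meas Q (h hQ)
  hμ := fun Q hQ => H.hμ Q (h hQ)
  hσ := fun Q hQ => H.hσ Q (h hQ)
  hu := fun Q hQ => H.hu Q (h hQ)
  apq := fun Q hQ => H.apq Q (h hQ)
  hold := H.hold
  tower := fun x Ts R hR hT hx => H.tower x Ts R (h hR) (hT.trans h) hx

theorem Hyp.nonempty {X : Type*} [MeasurableSpace X] {μ σ u : Measure X} {a b : ℝ} {L D : ℝ≥0∞}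
    {Qs : Finset (Set X)} (H : Hyp μ σ u a b L D Qs) : ∀ Q ∈ Qs, Q.Nonempty :=
  fun Q hQ => nonempty_of_measure_ne_zero (H.hμ Q hQ).1

theorem test_i {m s u L : ℝ≥0∞} {a b : ℝ} (ha : 0 < a) (hb : 0 < b) (m0 : m ≠ 0) (m1 : m ≠ ⊤)
    (h : s ^ a * u ^ b ≤ L * m ^ (a + b)) : (s / m) ^ (a / b) * u ≤ L ^ (1 / b) * m := by
  have h1 : (s / m) ^ a * u ^ b ≤ L * m ^ b := by
    rw [ENNReal.div_rpow_of_nonneg _ _ ha.le]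
    calc s ^ a / m ^ a * u ^ b = (s ^ a * u ^ b) * (m ^ a)⁻¹ := by
          simp only [div_eq_mul_inv]; ring
      _ ≤ L * m ^ (a + b) * (m ^ a)⁻¹ := by gcongr
      _ = L * m ^ b * (m ^ a * (m ^ a)⁻¹) := by rw [ENNReal.rpow_add _ _ m0 m1]; ring
      _ = _ := by
        rw [ENNReal.mul_inv_cancel (by simp [m0, m1]) (by simp [m0, m1]),
          mul_one]
  have h2 := ENNReal.rpow_le_rpow h1 (by positivity : 0 ≤ 1 / b)
  rw [ENNReal.mul_rpow_of_nonneg _ _ (by positivity), ENNReal.mul_rpow_of_nonneg _ _ (by positivity),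
    ← ENNReal.rpow_mul, ← ENNReal.rpow_mul, ← ENNReal.rpow_mul, mul_one_div_cancel hb.ne',
    ENNReal.rpow_one, ENNReal.rpow_one, mul_one_div] at h2
  exact h2

theorem test_iv {m mE s sE uu uE L : ℝ≥0∞} {a b : ℝ} (ha : 0 < a) (hb : 0 < b) (hab : a + b < 1)
    (m0 : m ≠ 0) (m1 : m ≠ ⊤)
    (h : s ^ a * uu ^ b ≤ L * m ^ (a + b)) (hE : mE ^ (a + b) ≤ sE ^ a * uE ^ b) (huE : uE ≤ uu)
    (hm : m ≤ 2 * mE) : s ≤ (2 * L) ^ (1 / a) * sE := by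
  have h0 : m ^ (a + b) ≠ 0 := by simp [m0, m1]
  have h00 : m ^ (a + b) ≠ ⊤ := by simp [m0, m1]
  have h1 : m ^ (a + b) ≤ 2 * (sE ^ a * uu ^ b) := by
    calc m ^ (a + b) ≤ (2 * mE) ^ (a + b) := ENNReal.rpow_le_rpow hm (by positivity)
      _ = 2 ^ (a + b) * mE ^ (a + b) := ENNReal.mul_rpow_of_nonneg _ _ (by positivity)
      _ ≤ 2 ^ (1:ℝ) * (sE ^ a * uu ^ b) := by
        refine mul_le_mul' (ENNReal.rpow_le_rpow_of_exponent_le (by norm_num) hab.le) (hE.trans ?_)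
        gcongr
      _ = _ := by rw [ENNReal.rpow_one]
  have h2 : m ^ (a + b) * s ^ a ≤ m ^ (a + b) * (2 * L * sE ^ a) := by
    calc m ^ (a + b) * s ^ a ≤ 2 * (sE ^ a * uu ^ b) * s ^ a := by gcongr
      _ = 2 * sE ^ a * (s ^ a * uu ^ b) := by ring
      _ ≤ 2 * sE ^ a * (L * m ^ (a + b)) := by gcongr
      _ = _ := by ring
  have h3 := (ENNReal.mul_le_mul_iff_right h0 h00).1 h2
  have h4 := ENNReal.rpow_le_rpow h3 (by positivity : 0 ≤ 1 / a)
  rwa [ENNReal.mul_rpow_of_nonneg _ _ (by positivity), ← ENNReal.rpow_mul, ← ENNReal.rpow_mul,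
    mul_one_div_cancel ha.ne', ENNReal.rpow_one, ENNReal.rpow_one] at h4

theorem test_ii {m s : ℝ≥0∞} {a b : ℝ} (hb : 0 < b) (hab : a + b < 1) (m0 : m ≠ 0) (m1 : m ≠ ⊤) :
    m ^ ((1 - a - b) / b) * (s / m) ^ ((1 - a) / b) * m = s ^ ((1 - a) / b) := by
  have e : (1 - a) / b = (1 - a - b) / b + 1 := by field_simp; ring
  have e0 : 0 ≤ (1 - a) / b := by apply div_nonneg <;> linarith
  calc _ = (m ^ ((1 - a - b) / b) * m ^ (1:ℝ)) * (s / m) ^ ((1 - a) / b) := by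
        rw [ENNReal.rpow_one]; ring
    _ = m ^ ((1 - a) / b) * (s / m) ^ ((1 - a) / b) := by rw [← ENNReal.rpow_add _ _ m0 m1, ← e]
    _ = (m * (s / m)) ^ ((1 - a) / b) := by rw [ENNReal.mul_rpow_of_nonneg _ _ e0]
    _ = _ := by rw [ENNReal.mul_div_cancel m0 m1]

theorem test_iii {m s : ℝ≥0∞} {t : ℝ} (m0 : m ≠ 0) (m1 : m ≠ ⊤) :
    m ^ (t - 1) * s = m ^ t * (s / m) := by
  rw [ENNReal.rpow_sub _ _ m0 m1, ENNReal.rpow_one]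
  simp only [div_eq_mul_inv]; ring

/-- pointwise estimate on a tower -/
theorem tower_point {X : Type*} {Fs : Finset (Set X)} (hL : Lam Fs) (ψ : Set X → ℝ≥0∞)
    (m : Set X → ℝ≥0∞)
    (hst : ∀ F ∈ Fs, ∀ F' ∈ Fs, F' ⊂ F → 2 * ψ F < ψ F') {a b s : ℝ} (ha : 0 < a) (hb : 0 < b)
    (hab : a + b < 1) (x : X)
    (T : Finset (Set X)) (hT : T ⊆ Fs) (hx : ∀ F ∈ T, x ∈ F) (M : ℝ≥0∞) (hM : ∀ F ∈ T, ψ F ≤ M) :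
    (∑ F ∈ T, m F ^ s * ψ F) ^ (1 / b) ≤ Geo (2 ^ (-(a / (1 - b)))) ^ ((1 - b) / b) *
      ∑ F ∈ T, m F ^ (s / b) * ψ F ^ ((1 - a) / b) * M ^ (a / b) := by
  have hb1 : 0 < 1 - b := by linarith
  have hpq : (1 / b).HolderConjugate (1 / (1 - b)) := by
    rw [Real.holderConjugate_iff]
    refine ⟨?_, by simp⟩
    rw [lt_div_iff₀ hb]; linarith
  have h1 := ENNReal.inner_le_Lp_mul_Lq T (fun F => m F ^ s * ψ F ^ (1 - a)) (fun F => ψ F ^ a) hpq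
  have e1 : ∑ F ∈ T, m F ^ s * ψ F ^ (1 - a) * ψ F ^ a = ∑ F ∈ T, m F ^ s * ψ F := by
    refine Finset.sum_congr rfl fun F _ => ?_
    rw [mul_assoc, ← ENNReal.rpow_add_of_nonneg _ _ (by linarith) ha.le, sub_add_cancel,
      ENNReal.rpow_one]
  have e2 : ∑ F ∈ T, (ψ F ^ a) ^ (1 / (1 - b)) ≤
      Geo (2 ^ (-(a / (1 - b)))) * M ^ (a / (1 - b)) := by
    refine le_trans (le_of_eq ?_)
      (tower_sum hL ψ hst (r := a / (1 - b)) (by positivity) x T hT hx M hM)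
    refine Finset.sum_congr rfl fun F _ => ?_
    rw [← ENNReal.rpow_mul, mul_one_div]
  rw [e1] at h1
  have h2 := ENNReal.rpow_le_rpow h1 (by positivity : 0 ≤ 1 / b)
  refine h2.trans ?_
  rw [ENNReal.mul_rpow_of_nonneg _ _ (by positivity), ← ENNReal.rpow_mul, ← ENNReal.rpow_mul]
  have e3 : 1 / (1 / b) * (1 / b) = 1 := by field_simp
  have e4 : 1 / (1 / (1 - b)) * (1 / b) = (1 - b) / b := by field_simp
  rw [e3, e4, ENNReal.rpow_one]
  calc _ ≤ (∑ F ∈ T, (m F ^ s * ψ F ^ (1 - a)) ^ (1 / b)) *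
        (Geo (2 ^ (-(a / (1 - b)))) * M ^ (a / (1 - b))) ^ ((1 - b) / b) := by
        gcongr
    _ = _ := by
      rw [ENNReal.mul_rpow_of_nonneg _ _ (by positivity), ← ENNReal.rpow_mul, Finset.mul_sum,
        Finset.sum_mul]
      refine Finset.sum_congr rfl fun F _ => ?_
      rw [ENNReal.mul_rpow_of_nonneg _ _ (by positivity), ← ENNReal.rpow_mul, ← ENNReal.rpow_mul,
        mul_one_div, mul_one_div]
      have e5 : a / (1 - b) * ((1 - b) / b) = a / b := by field_simp
      rw [e5]; ring

/-- the constant in the testing condition -/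
def Ctest (a b : ℝ) (D L : ℝ≥0∞) : ℝ≥0∞ :=
  (2 * D) ^ (1 / b) * (Geo (2 ^ (-(a / (1 - b)))) ^ ((1 - b) / b) *
    (2 * L ^ (1 / b) * (2 * L) ^ (1 / a)))

open scoped Classical in
theorem testing {X : Type*} [MeasurableSpace X] {μ σ u : Measure X} {a b : ℝ} {L D : ℝ≥0∞}
    {Qs : Finset (Set X)} (H : Hyp μ σ u a b L D Qs) (R : Set X) (hR : ∀ Q ∈ Qs, Q ⊆ R) :
    ∫⁻ x, (∑ Q ∈ Qs, Q.indicator (fun _ => μ Q ^ ((1 - a - b) - 1) * σ Q) x) ^ (1 / b) ∂u ≤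
      Ctest a b D L * σ R ^ ((1 - a) / b) := by
  have ha := H.ha
  have hb := H.hb
  have hab := H.hab
  set ψ : Set X → ℝ≥0∞ := fun Q => σ Q / μ Q with hψ
  obtain ⟨S, hS, hπ, hst⟩ := stopping 2 (by norm_num) ψ Qs H.lam H.nonempty
  have HS := H.mono hS
  set s := 1 - a - b with hs
  set G := Geo (2 ^ (-(a / (1 - b)))) with hG
  -- pointwise domination by the stopping family
  have p1 : ∀ x, ∑ Q ∈ Qs, Q.indicator (fun _ => μ Q ^ (s - 1) * σ Q) x ≤
      2 * D * ∑ F ∈ S.filter (fun F => x ∈ F), μ F ^ s * ψ F := by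
    intro x
    have : ∀ Q ∈ Qs, Q.indicator (fun _ => μ Q ^ (s - 1) * σ Q) x ≤
        ∑ F ∈ S.filter (fun F => x ∈ F),
          if x ∈ Q ∧ Q ⊆ F then 2 * ψ F * μ Q ^ s else 0 := by
      intro Q hQ
      by_cases hx : x ∈ Q
      · rw [Set.indicator_of_mem hx]
        obtain ⟨F, hF, h1, h2, -⟩ := hπ Q hQ
        refine le_trans ?_ (Finset.single_le_sum (f := fun F => if x ∈ Q ∧ Q ⊆ F then
          2 * ψ F * μ Q ^ s else 0) (fun _ _ => by simp)
          (show F ∈ S.filter (fun F => x ∈ F) by simp [hF, h1 hx]))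
        simp only [hx, h1, and_self, if_true]
        rw [test_iii (H.hμ Q hQ).1 (H.hμ Q hQ).2, mul_comm]
        gcongr
      · rw [Set.indicator_of_notMem hx]; simp
    refine (Finset.sum_le_sum this).trans ?_
    rw [Finset.sum_comm, Finset.mul_sum]
    refine Finset.sum_le_sum fun F hF => ?_
    rw [Finset.mem_filter] at hF
    rw [← Finset.sum_filter, ← Finset.mul_sum]
    have ht := H.tower x (Qs.filter (fun Q => x ∈ Q ∧ Q ⊆ F)) F (hS hF.1) (Finset.filter_subset _ _)
      (fun Q hQ => (Finset.mem_filter.1 hQ).2)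
    calc _ ≤ 2 * ψ F * (D * μ F ^ s) := by gcongr
      _ = _ := by ring
  have p2 : ∀ x, (∑ F ∈ S.filter (fun F => x ∈ F), μ F ^ s * ψ F) ^ (1 / b) ≤
      G ^ ((1 - b) / b) * ∑ F ∈ S, μ F ^ (s / b) * ψ F ^ ((1 - a) / b) *
        ∑ F' ∈ S.filter (fun F' => F' ⊆ F), F'.indicator (fun _ => ψ F' ^ (a / b)) x := by
    intro x
    set T := S.filter (fun F => x ∈ F) with hT
    rcases T.eq_empty_or_nonempty with h0 | hne
    · rw [h0, Finset.sum_empty, ENNReal.zero_rpow_of_pos (by positivity)]; simp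
    obtain ⟨Fm, hFm, hmax⟩ := T.exists_max_image ψ hne
    refine (tower_point HS.lam ψ (fun F => μ F) hst (s := s) ha hb hab x T (Finset.filter_subset _ _)
      (fun F hF => (Finset.mem_filter.1 hF).2) (ψ Fm) hmax).trans ?_
    gcongr _ * ?_
    refine (Finset.sum_le_sum (g := fun F => μ F ^ (s / b) * ψ F ^ ((1 - a) / b) *
        ∑ F' ∈ S.filter (fun F' => F' ⊆ F), F'.indicator (fun _ => ψ F' ^ (a / b)) x) ?_).trans
      (Finset.sum_le_sum_of_subset (Finset.filter_subset _ _))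
    intro F hF
    gcongr _ * ?_
    rw [hT, Finset.mem_filter] at hF hFm
    have hsub : Fm ⊆ F := by
      rcases HS.lam F hF.1 Fm hFm.1 with h | h | h
      · by_contra hcon
        have h1 := hst Fm hFm.1 F hF.1 ⟨h, hcon⟩
        have h2 := hmax F (by simp [hT, hF])
        exact absurd (h1.trans_le h2) (not_lt.2 (le_mul_of_one_le_left (by simp) (by norm_num)))
      · exact h
      · exact absurd hFm.2 (Set.disjoint_left.1 h hF.2)
    refine le_trans ?_ (Finset.single_le_sum (f := fun F' : Set X =>
      F'.indicator (fun _ => ψ F' ^ (a / b)) x) (fun _ _ => by simp)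
      (show Fm ∈ S.filter (fun F' => F' ⊆ F) by simp [hFm.1, hsub]))
    simp [Set.indicator_of_mem hFm.2]
  have half : ∀ F ∈ S, μ F ≤ 2 * μ (Erem S F) := fun F hF =>
    Erem_half μ σ HS.lam HS.meas HS.hμ HS.hσ hst hF
  have p3 : ∀ F ∈ S, ∑ F' ∈ S.filter (fun F' => F' ⊆ F), ψ F' ^ (a / b) * u F' ≤
      2 * L ^ (1 / b) * μ F := by
    intro F hF
    calc _ ≤ ∑ F' ∈ S.filter (fun F' => F' ⊆ F), L ^ (1 / b) * (2 * μ (Erem S F')) := by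
          refine Finset.sum_le_sum fun F' hF' => ?_
          rw [Finset.mem_filter] at hF'
          refine (test_i ha hb (HS.hμ F' hF'.1).1 (HS.hμ F' hF'.1).2 (HS.apq F' hF'.1)).trans ?_
          gcongr
          exact half F' hF'.1
      _ = 2 * L ^ (1 / b) * ∑ F' ∈ S.filter (fun F' => F' ⊆ F), μ (Erem S F') := by
          rw [Finset.mul_sum]; refine Finset.sum_congr rfl fun F' _ => by ring
      _ ≤ _ := by
          gcongr
          exact sum_Erem_le μ HS.lam HS.meas (Finset.filter_subset _ _)
            (fun F' hF' => (Finset.mem_filter.1 hF').2)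
  have p4 : ∑ F ∈ S, σ F ≤ (2 * L) ^ (1 / a) * σ R := by
    calc _ ≤ ∑ F ∈ S, (2 * L) ^ (1 / a) * σ (Erem S F) := by
          refine Finset.sum_le_sum fun F hF => ?_
          exact test_iv ha hb hab (HS.hμ F hF).1 (HS.hμ F hF).2 (HS.apq F hF)
            (HS.hold _ (Erem_meas HS.meas hF)) (measure_mono Erem_subset) (half F hF)
      _ ≤ _ := by
          rw [← Finset.mul_sum]
          gcongr
          exact sum_Erem_le σ HS.lam HS.meas subset_rfl (fun F hF => hR F (hS hF))
  have p5 : ∑ F ∈ S, σ F ^ ((1 - a) / b) ≤ (2 * L) ^ (1 / a) * σ R ^ ((1 - a) / b) := by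
    have e0 : 0 ≤ (1 - a) / b - 1 := by
      rw [sub_nonneg, le_div_iff₀ hb]; linarith
    have key : ∀ y : ℝ≥0∞, y ^ ((1 - a) / b) = y ^ ((1 - a) / b - 1) * y := by
      intro y
      conv_rhs => rw [← ENNReal.rpow_one y]
      rw [← ENNReal.rpow_mul, one_mul, ← ENNReal.rpow_add_of_nonneg _ _ e0 zero_le_one,
        sub_add_cancel]
    calc _ ≤ ∑ F ∈ S, σ R ^ ((1 - a) / b - 1) * σ F := by
          refine Finset.sum_le_sum fun F hF => ?_
          rw [key]
          gcongr
          exact hR F (hS hF)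
      _ = σ R ^ ((1 - a) / b - 1) * ∑ F ∈ S, σ F := by rw [Finset.mul_sum]
      _ ≤ σ R ^ ((1 - a) / b - 1) * ((2 * L) ^ (1 / a) * σ R) := by gcongr
      _ = _ := by rw [key (σ R)]; ring
  calc _ ≤ ∫⁻ x, (2 * D) ^ (1 / b) * (G ^ ((1 - b) / b) * ∑ F ∈ S, μ F ^ (s / b) *
        ψ F ^ ((1 - a) / b) *
        ∑ F' ∈ S.filter (fun F' => F' ⊆ F), F'.indicator (fun _ => ψ F' ^ (a / b)) x) ∂u := by
        refine lintegral_mono fun x => ?_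
        refine (ENNReal.rpow_le_rpow (p1 x) (by positivity)).trans ?_
        rw [ENNReal.mul_rpow_of_nonneg _ _ (by positivity)]
        gcongr _ * ?_
        exact p2 x
    _ = (2 * D) ^ (1 / b) * (G ^ ((1 - b) / b) * ∑ F ∈ S, μ F ^ (s / b) *
        ψ F ^ ((1 - a) / b) * ∑ F' ∈ S.filter (fun F' => F' ⊆ F), ψ F' ^ (a / b) * u F') := by
        have hmi : ∀ F' ∈ S, Measurable (fun x => F'.indicator (fun _ => ψ F' ^ (a / b)) x) :=
          fun F' hF' => measurable_const.indicator (HS.meas F' hF')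
        have hm1 : ∀ F, Measurable (fun x => ∑ F' ∈ S.filter (fun F' => F' ⊆ F),
            F'.indicator (fun _ => ψ F' ^ (a / b)) x) := fun F =>
          Finset.measurable_fun_sum _ (fun F' hF' => hmi F' (Finset.mem_filter.1 hF').1)
        have hm2 : ∀ F, Measurable (fun x => μ F ^ (s / b) * ψ F ^ ((1 - a) / b) *
            ∑ F' ∈ S.filter (fun F' => F' ⊆ F), F'.indicator (fun _ => ψ F' ^ (a / b)) x) :=
          fun F => (hm1 F).const_mul _
        have hm3 := Finset.measurable_fun_sum S (fun F _ => hm2 F)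
        rw [lintegral_const_mul _ (hm3.const_mul _), lintegral_const_mul _ hm3,
          lintegral_finsetSum _ (fun F _ => hm2 F)]
        congr 2
        refine Finset.sum_congr rfl fun F _ => ?_
        rw [lintegral_const_mul _ (hm1 F), lintegral_finsetSum _
          (fun F' hF' => hmi F' (Finset.mem_filter.1 hF').1)]
        congr 1
        refine Finset.sum_congr rfl fun F' hF' => ?_
        rw [lintegral_indicator_const (HS.meas F' (Finset.mem_filter.1 hF').1)]
    _ ≤ (2 * D) ^ (1 / b) * (G ^ ((1 - b) / b) * ∑ F ∈ S, μ F ^ (s / b) *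
        ψ F ^ ((1 - a) / b) * (2 * L ^ (1 / b) * μ F)) := by
        gcongr with F hF
        exact p3 F hF
    _ = (2 * D) ^ (1 / b) * (G ^ ((1 - b) / b) * (2 * L ^ (1 / b) *
        ∑ F ∈ S, σ F ^ ((1 - a) / b))) := by
        congr 2
        rw [Finset.mul_sum]
        refine Finset.sum_congr rfl fun F hF => ?_
        rw [← test_ii (s := σ F) hb hab (HS.hμ F hF).1 (HS.hμ F hF).2]
        ring
    _ ≤ (2 * D) ^ (1 / b) * (G ^ ((1 - b) / b) * (2 * L ^ (1 / b) *
        ((2 * L) ^ (1 / a) * σ R ^ ((1 - a) / b)))) := by gcongr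
    _ = _ := by unfold Ctest; ring

theorem sum_rpow_le {ι : Type*} (T : Finset ι) (c : ι → ℝ≥0∞) (B : ℝ≥0∞) (h : ∑ i ∈ T, c i ≤ B)
    {t : ℝ} (ht : 1 ≤ t) : ∑ i ∈ T, c i ^ t ≤ B ^ t := by
  have key : ∀ y : ℝ≥0∞, y ^ t = y ^ (t - 1) * y := by
    intro y
    conv_rhs => rw [← ENNReal.rpow_one y]
    rw [← ENNReal.rpow_mul, one_mul, ← ENNReal.rpow_add_of_nonneg _ _ (by linarith) zero_le_one,
      sub_add_cancel]
  calc _ ≤ ∑ i ∈ T, B ^ (t - 1) * c i := by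
        refine Finset.sum_le_sum fun i hi => ?_
        rw [key]
        have : c i ≤ B := (Finset.single_le_sum (f := c) (fun _ _ => by simp) hi).trans h
        gcongr
    _ ≤ B ^ (t - 1) * B := by rw [← Finset.mul_sum]; gcongr
    _ = _ := (key B).symm

/-- constant of the embedding -/
def Cemb (p : ℝ) : ℝ≥0∞ := 2 * (Geo (2 ^ (-(p - 1))) * 2 ^ (p - 1))

open scoped Classical in
theorem embedding {X : Type*} [MeasurableSpace X] {σ : Measure X} {p : ℝ} (hp : 1 < p)
    {f : X → ℝ≥0∞} (hf : Measurable f) {Fs : Finset (Set X)} (hL : Lam Fs)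
    (hm : ∀ F ∈ Fs, MeasurableSet F) (hσ : ∀ F ∈ Fs, σ F ≠ 0 ∧ σ F ≠ ⊤)
    (hfin : ∀ F ∈ Fs, ∫⁻ x in F, f x ∂σ ≠ ⊤)
    (hst : ∀ F ∈ Fs, ∀ F' ∈ Fs, F' ⊂ F →
      2 * ((∫⁻ x in F, f x ∂σ) / σ F) < (∫⁻ x in F', f x ∂σ) / σ F') :
    ∑ F ∈ Fs, ((∫⁻ x in F, f x ∂σ) / σ F) ^ p * σ F ≤ Cemb p * ∫⁻ x, f x ^ p ∂σ := by
  set φ : Set X → ℝ≥0∞ := fun F => (∫⁻ x in F, f x ∂σ) / σ F with hφ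
  have hp1 : 0 < p - 1 := by linarith
  have key : ∀ y : ℝ≥0∞, y ^ p = y ^ (p - 1) * y := by
    intro y
    conv_rhs => rw [← ENNReal.rpow_one y]
    rw [← ENNReal.rpow_mul, one_mul, ← ENNReal.rpow_add_of_nonneg _ _ (by linarith) zero_le_one,
      sub_add_cancel]
  set V : Set X → Set X := fun F => F ∩ {x | φ F ≤ 2 * f x} with hV
  have hVm : ∀ F ∈ Fs, MeasurableSet (V F) := fun F hF =>
    (hm F hF).inter (measurableSet_le measurable_const (hf.const_mul 2))
  have h1 : ∀ F ∈ Fs, φ F * σ F ≤ 2 * ∫⁻ x, (V F).indicator f x ∂σ := by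
    intro F hF
    have e : φ F * σ F = ∫⁻ x in F, f x ∂σ := ENNReal.div_mul_cancel (hσ F hF).1 (hσ F hF).2
    have h2 : ∫⁻ x in F, f x ∂σ ≤ ∫⁻ x, (V F).indicator f x ∂σ + φ F / 2 * σ F := by
      rw [← lintegral_indicator_const (hm F hF), ← lintegral_indicator (hm F hF),
        ← lintegral_add_left (hf.indicator (hVm F hF))]
      refine lintegral_mono fun x => ?_
      by_cases hx : x ∈ F
      · by_cases hx2 : φ F ≤ 2 * f x
        · rw [Set.indicator_of_mem hx, Set.indicator_of_mem (show x ∈ V F from ⟨hx, hx2⟩)]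
          exact le_self_add
        · rw [Set.indicator_of_mem hx, Set.indicator_of_mem hx]
          refine le_add_left ?_
          rw [ENNReal.le_div_iff_mul_le (by simp) (by simp), mul_comm]
          exact (not_le.1 hx2).le
      · simp [hx]
    have e2 : φ F / 2 * σ F = (∫⁻ x in F, f x ∂σ) / 2 := by
      rw [← e]; simp only [div_eq_mul_inv]; ring
    rw [e2] at h2
    rw [e]
    set I := ∫⁻ x in F, f x ∂σ with hI
    have hI2 : I / 2 ≠ ⊤ := ENNReal.div_ne_top (hfin F hF) (by norm_num)
    have h4 : I / 2 ≤ ∫⁻ x, (V F).indicator f x ∂σ := by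
      have : I / 2 + I / 2 ≤ ∫⁻ x, (V F).indicator f x ∂σ + I / 2 := by rwa [ENNReal.add_halves]
      exact (ENNReal.add_le_add_iff_right hI2).1 this
    calc I = 2 * (I / 2) := by rw [ENNReal.mul_div_cancel (by norm_num) (by norm_num)]
      _ ≤ _ := by gcongr
  calc ∑ F ∈ Fs, φ F ^ p * σ F
      ≤ ∑ F ∈ Fs, 2 * ∫⁻ x, φ F ^ (p - 1) * (V F).indicator f x ∂σ := by
        refine Finset.sum_le_sum fun F hF => ?_
        rw [key, mul_assoc, lintegral_const_mul _ (hf.indicator (hVm F hF))]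
        calc _ ≤ φ F ^ (p - 1) * (2 * ∫⁻ x, (V F).indicator f x ∂σ) := by gcongr _ * ?_; exact h1 F hF
          _ = _ := by ring
    _ = 2 * ∫⁻ x, ∑ F ∈ Fs, φ F ^ (p - 1) * (V F).indicator f x ∂σ := by
        rw [lintegral_finsetSum _ (fun F hF => (hf.indicator (hVm F hF)).const_mul _),
          Finset.mul_sum]
    _ ≤ 2 * ∫⁻ x, Geo (2 ^ (-(p - 1))) * 2 ^ (p - 1) * f x ^ p ∂σ := by
        gcongr with x
        have e3 : ∑ F ∈ Fs, φ F ^ (p - 1) * (V F).indicator f x =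
            (∑ F ∈ Fs.filter (fun F => x ∈ V F), φ F ^ (p - 1)) * f x := by
          rw [Finset.sum_filter, Finset.sum_mul]
          refine Finset.sum_congr rfl fun F _ => ?_
          by_cases hx : x ∈ V F <;> simp [hx]
        rw [e3]
        calc _ ≤ Geo (2 ^ (-(p - 1))) * (2 * f x) ^ (p - 1) * f x := by
              gcongr
              exact tower_sum hL φ hst hp1 x _ (Finset.filter_subset _ _)
                (fun F hF => (Finset.mem_filter.1 hF).2.1) _
                (fun F hF => (Finset.mem_filter.1 hF).2.2)
          _ = _ := by
            rw [ENNReal.mul_rpow_of_nonneg _ _ hp1.le, key (f x)]; ring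
    _ = _ := by
        rw [lintegral_const_mul _ (hf.pow_const p)]; unfold Cemb; ring

/-- stopping children -/
def ch {X : Type*} (Fs : Finset (Set X)) (F : Set X) : Finset (Set X) :=
  open scoped Classical in
  Fs.filter (fun F' => F' ⊂ F ∧ ∀ F'' ∈ Fs, F' ⊂ F'' → F ⊆ F'')

theorem mem_ch {X : Type*} {Fs : Finset (Set X)} {F F' : Set X} :
    F' ∈ ch Fs F ↔ F' ∈ Fs ∧ F' ⊂ F ∧ ∀ F'' ∈ Fs, F' ⊂ F'' → F ⊆ F'' := by
  classical
  simp [ch]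

theorem ch_cover {X : Type*} {Fs : Finset (Set X)} (hL : Lam Fs) {F : Set X} (hF : F ∈ Fs) {x : X}
    (hx : x ∈ F) (hx2 : x ∉ Erem Fs F) : ∃ F' ∈ ch Fs F, x ∈ F' := by
  classical
  have hne : (Fs.filter (fun F' => F' ⊂ F ∧ x ∈ F')).Nonempty := by
    rw [mem_Erem] at hx2
    push Not at hx2
    obtain ⟨F', h1, h2, h3⟩ := hx2 hx
    exact ⟨F', by simp [h1, h2, h3]⟩
  obtain ⟨F', hm⟩ := Finset.exists_maximal hne
  have h1 := hm.1
  simp only [Finset.mem_filter] at h1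
  refine ⟨F', mem_ch.2 ⟨h1.1, h1.2.1, ?_⟩, h1.2.2⟩
  intro F'' hF'' hs
  have hx'' : x ∈ F'' := hs.1 h1.2.2
  rcases hL F hF F'' hF'' with h | h | h
  · exact h
  · by_contra hcon
    exact hs.2 (hm.2 (by simp [hF'', hx'', Set.ssubset_def, h, hcon]) hs.1)
  · exact absurd hx'' (Set.disjoint_left.1 h hx)

theorem ch_unique {X : Type*} {Fs : Finset (Set X)} (hL : Lam Fs) {F F1 F2 : Set X} {x : X}
    (h1 : F1 ∈ ch Fs F) (h2 : F2 ∈ ch Fs F) (hx1 : x ∈ F1) (hx2 : x ∈ F2) : F1 = F2 := by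
  rw [mem_ch] at h1 h2
  by_contra hne
  rcases hL F1 h1.1 F2 h2.1 with h | h | h
  · exact h2.2.1.2 (h1.2.2 F2 h2.1 (lt_of_le_of_ne h hne))
  · exact h1.2.1.2 (h2.2.2 F1 h1.1 (lt_of_le_of_ne h (Ne.symm hne)))
  · exact Set.disjoint_left.1 h hx1 hx2

theorem ch_sum {X : Type*} {Fs : Finset (Set X)} (c : Set X → ℝ≥0∞) :
    ∑ F ∈ Fs, ∑ F' ∈ ch Fs F, c F' ≤ ∑ F ∈ Fs, c F := by
  classical
  have h1 : ∀ F ∈ Fs, ∑ F' ∈ ch Fs F, c F' = ∑ F' ∈ Fs, if F' ∈ ch Fs F then c F' else 0 := by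
    intro F _
    rw [← Finset.sum_filter]
    congr 1
    ext F'
    simp only [Finset.mem_filter]
    exact ⟨fun h => ⟨(mem_ch.1 h).1, h⟩, fun h => h.2⟩
  rw [Finset.sum_congr rfl h1, Finset.sum_comm]
  refine Finset.sum_le_sum fun F' _ => ?_
  by_cases h : ∃ F ∈ Fs, F' ∈ ch Fs F
  · obtain ⟨F, hF, h⟩ := h
    rw [Finset.sum_eq_single F]
    · simp [h]
    · intro G hG hne
      rw [if_neg]
      intro h2
      rw [mem_ch] at h h2
      exact hne (Set.Subset.antisymm (h2.2.2 F hF h.2.1) (h.2.2 G hG h2.2.1))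
    · exact fun h' => absurd hF h'
  · push Not at h
    rw [Finset.sum_eq_zero]
    · simp
    · intro F hF; rw [if_neg (h F hF)]

/-- localized dual function -/
def gF {X : Type*} (Fs : Finset (Set X)) (g : X → ℝ≥0∞) (γ : Set X → ℝ≥0∞) (F : Set X) (x : X) :
    ℝ≥0∞ := (Erem Fs F).indicator g x + ∑ F' ∈ ch Fs F, F'.indicator (fun _ => γ F') x

theorem gF_meas {X : Type*} [MeasurableSpace X] {Fs : Finset (Set X)}
    (hm : ∀ F ∈ Fs, MeasurableSet F) {g : X → ℝ≥0∞} (hg : Measurable g) (γ : Set X → ℝ≥0∞)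
    {F : Set X} (hF : F ∈ Fs) : Measurable (gF Fs g γ F) :=
  (hg.indicator (Erem_meas hm hF)).add
    (Finset.measurable_fun_sum _ fun F' hF' =>
      measurable_const.indicator (hm F' (mem_ch.1 hF').1))

theorem gF_pow {X : Type*} [MeasurableSpace X] {u : Measure X} {Fs : Finset (Set X)}
    (hL : Lam Fs) (hm : ∀ F ∈ Fs, MeasurableSet F) {g : X → ℝ≥0∞} (hg : Measurable g)
    (γ : Set X → ℝ≥0∞) {F : Set X} (hF : F ∈ Fs) {r : ℝ} (hr : 0 < r) :
    ∫⁻ x, gF Fs g γ F x ^ r ∂u ≤ ∫⁻ x in Erem Fs F, g x ^ r ∂u + ∑ F' ∈ ch Fs F, γ F' ^ r * u F' := by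
  have hmc : ∀ F' ∈ ch Fs F, Measurable (F'.indicator (fun _ : X => γ F' ^ r)) := fun F' hF' =>
      measurable_const.indicator (hm F' (mem_ch.1 hF').1)
  have e : ∫⁻ x in Erem Fs F, g x ^ r ∂u + ∑ F' ∈ ch Fs F, γ F' ^ r * u F' =
      ∫⁻ x, ((Erem Fs F).indicator (fun x => g x ^ r) x +
        ∑ F' ∈ ch Fs F, F'.indicator (fun _ => γ F' ^ r) x) ∂u := by
    rw [lintegral_add_left ((hg.pow_const r).indicator (Erem_meas hm hF)),
      lintegral_indicator (Erem_meas hm hF), lintegral_finsetSum _ hmc]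
    congr 1
    refine Finset.sum_congr rfl fun F' hF' => ?_
    rw [lintegral_indicator_const (hm F' (mem_ch.1 hF').1)]
  rw [e]
  refine lintegral_mono fun x => ?_
  unfold gF
  by_cases hx : ∃ F' ∈ ch Fs F, x ∈ F'
  · obtain ⟨F', hF', hxF'⟩ := hx
    have hE : x ∉ Erem Fs F := by
      intro h
      rw [mem_Erem] at h
      exact h.2 F' (mem_ch.1 hF').1 (mem_ch.1 hF').2.1 hxF'
    have hs : ∀ c : Set X → ℝ≥0∞, ∑ F'' ∈ ch Fs F, F''.indicator (fun _ => c F'') x = c F' := by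
      intro c
      rw [Finset.sum_eq_single F']
      · simp [hxF']
      · intro G hG hne
        rw [Set.indicator_of_notMem]
        intro hxG
        exact hne (ch_unique hL hG hF' hxG hxF')
      · exact fun h => absurd hF' h
    rw [hs γ, hs (fun F => γ F ^ r), Set.indicator_of_notMem hE, Set.indicator_of_notMem hE]
    simp
  · push Not at hx
    have hs : ∀ c : Set X → ℝ≥0∞, ∑ F'' ∈ ch Fs F, F''.indicator (fun _ => c F'') x = 0 := by
      intro c
      refine Finset.sum_eq_zero fun G hG => ?_
      rw [Set.indicator_of_notMem (hx G hG)]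
    rw [hs γ, hs (fun F => γ F ^ r)]
    by_cases hE : x ∈ Erem Fs F
    · simp [hE]
    · simp [hE, hr]

theorem gF_ge {X : Type*} [MeasurableSpace X] {u : Measure X} {Fs : Finset (Set X)}
    (hL : Lam Fs) (hm : ∀ F ∈ Fs, MeasurableSet F) (hu : ∀ F ∈ Fs, u F ≠ 0 ∧ u F ≠ ⊤)
    {g : X → ℝ≥0∞} (hg : Measurable g) {F Q : Set X} (hF : F ∈ Fs) (hQm : MeasurableSet Q)
    (hQF : Q ⊆ F) (hQ : ∀ F' ∈ ch Fs F, F' ⊆ Q ∨ Disjoint F' Q) :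
    ∫⁻ x in Q, g x ∂u ≤
      ∫⁻ x in Q, gF Fs g (fun F => (∫⁻ x in F, g x ∂u) / u F) F x ∂u := by
  classical
  have hmE := Erem_meas hm hF
  have hmc : ∀ F' ∈ ch Fs F, MeasurableSet F' := fun F' hF' => (hm F' (mem_ch.1 hF').1)
  calc ∫⁻ x in Q, g x ∂u ≤ ∫⁻ x, ((Q ∩ Erem Fs F).indicator g x +
        ∑ F' ∈ (ch Fs F).filter (fun F' => F' ⊆ Q), F'.indicator g x) ∂u := by
        rw [← lintegral_indicator hQm]
        refine lintegral_mono fun x => ?_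
        by_cases hx : x ∈ Q
        · rw [Set.indicator_of_mem hx]
          by_cases hE : x ∈ Erem Fs F
          · rw [Set.indicator_of_mem (show x ∈ Q ∩ Erem Fs F from ⟨hx, hE⟩)]; exact le_self_add
          · obtain ⟨F', hF', hxF'⟩ := ch_cover hL hF (hQF hx) hE
            have hsub : F' ⊆ Q := by
              rcases hQ F' hF' with h | h
              · exact h
              · exact absurd hx (Set.disjoint_left.1 h hxF')
            refine le_add_left ?_
            refine le_trans ?_ (Finset.single_le_sum (f := fun F' : Set X => F'.indicator g x)
              (fun _ _ => by simp) (show F' ∈ (ch Fs F).filter (fun F' => F' ⊆ Q) by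
                simp [hF', hsub]))
            simp [hxF']
        · simp [hx]
    _ = ∫⁻ x in Q ∩ Erem Fs F, g x ∂u +
        ∑ F' ∈ (ch Fs F).filter (fun F' => F' ⊆ Q), ∫⁻ x in F', g x ∂u := by
        rw [lintegral_add_left (hg.indicator (hQm.inter hmE)), lintegral_indicator (hQm.inter hmE),
          lintegral_finsetSum _ (fun F' hF' => hg.indicator (hmc F' (Finset.mem_filter.1 hF').1))]
        congr 1
        refine Finset.sum_congr rfl fun F' hF' => ?_
        rw [lintegral_indicator (hmc F' (Finset.mem_filter.1 hF').1)]
    _ ≤ ∫⁻ x in Q ∩ Erem Fs F, g x ∂u +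
        ∑ F' ∈ ch Fs F, (∫⁻ x in F', g x ∂u) / u F' * u (F' ∩ Q) := by
        gcongr
        refine (Finset.sum_le_sum fun F' hF' => ?_).trans
          (Finset.sum_le_sum_of_subset (Finset.filter_subset _ _))
        rw [Finset.mem_filter] at hF'
        have := hu F' (mem_ch.1 hF'.1).1
        rw [Set.inter_eq_left.2 hF'.2, ENNReal.div_mul_cancel this.1 this.2]
    _ = _ := by
        unfold gF
        rw [lintegral_add_left (hg.indicator hmE), lintegral_finsetSum _ (fun F' hF' =>
          measurable_const.indicator (hmc F' hF')), lintegral_indicator hmE,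
          Measure.restrict_restrict hmE, Set.inter_comm]
        congr 1
        refine Finset.sum_congr rfl fun F' hF' => ?_
        rw [lintegral_indicator_const (hmc F' hF'), Measure.restrict_apply (hmc F' hF')]

def Cside (a b : ℝ) (D L : ℝ≥0∞) : ℝ≥0∞ :=
  2 * (Ctest a b D L ^ b *
    (Cemb (1 / (1 - a)) ^ (1 - a) * (1 + Cemb (1 / (1 - a))) ^ (1 - b)))

theorem setL_fin {X : Type*} [MeasurableSpace X] {σ : Measure X} {p : ℝ} (hp : 1 ≤ p)
    {f : X → ℝ≥0∞} (h : ∫⁻ x, f x ^ p ∂σ ≠ ⊤) {Q : Set X} (hQ : σ Q ≠ ⊤) :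
    ∫⁻ x in Q, f x ∂σ ≠ ⊤ := by
  have h1 : ∫⁻ x in Q, f x ∂σ ≤ ∫⁻ x in Q, (1 + f x ^ p) ∂σ := by
    refine lintegral_mono fun x => ?_
    rcases le_total (f x) 1 with h | h
    · exact h.trans le_self_add
    · refine le_add_left ?_
      calc f x = f x ^ (1:ℝ) := (ENNReal.rpow_one _).symm
        _ ≤ _ := ENNReal.rpow_le_rpow_of_exponent_le h hp
  rw [lintegral_add_left measurable_const] at h1
  simp only [lintegral_const, one_mul, Measure.restrict_apply_univ] at h1
  refine ne_top_of_le_ne_top ?_ h1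
  refine ENNReal.add_ne_top.2 ⟨hQ, ne_top_of_le_ne_top h (setLIntegral_le_lintegral _ _)⟩

open scoped Classical in
theorem one_side {X : Type*} [MeasurableSpace X] {μ σ u : Measure X} {a b : ℝ} {L D : ℝ≥0∞}
    {Qs : Finset (Set X)} (H : Hyp μ σ u a b L D Qs) {f g : X → ℝ≥0∞} (hf : Measurable f)
    (hg : Measurable g) (hf1 : ∫⁻ x, f x ^ (1 / (1 - a)) ∂σ ≤ 1)
    (hg1 : ∫⁻ x, g x ^ (1 / (1 - b)) ∂u ≤ 1)
    (hdom : ∀ Q ∈ Qs, ((∫⁻ x in Q, g x ∂u) / u Q) ^ (1 / (1 - b)) * u Q ≤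
      ((∫⁻ x in Q, f x ∂σ) / σ Q) ^ (1 / (1 - a)) * σ Q) :
    ∑ Q ∈ Qs, μ Q ^ ((1 - a - b) - 1) * (∫⁻ x in Q, f x ∂σ) * (∫⁻ x in Q, g x ∂u) ≤
      Cside a b D L := by
  have ha := H.ha
  have hb := H.hb
  have hab := H.hab
  have ha1 : 0 < 1 - a := by linarith
  have hb1 : 0 < 1 - b := by linarith
  have hp : 1 < 1 / (1 - a) := by rw [lt_div_iff₀ ha1]; linarith
  have hpq : (1 / b).HolderConjugate (1 / (1 - b)) := by
    rw [Real.holderConjugate_iff]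
    refine ⟨?_, by simp⟩
    rw [lt_div_iff₀ hb]; linarith
  set s := 1 - a - b with hs
  set p := 1 / (1 - a) with hpdef
  set r := 1 / (1 - b) with hrdef
  have hr0 : 0 < r := by positivity
  set φ : Set X → ℝ≥0∞ := fun Q => (∫⁻ x in Q, f x ∂σ) / σ Q with hφ
  set γ : Set X → ℝ≥0∞ := fun Q => (∫⁻ x in Q, g x ∂u) / u Q with hγ
  obtain ⟨Fs, hFs, hπ0, hst⟩ := stopping 2 (by norm_num) φ Qs H.lam H.nonempty
  have HF := H.mono hFs
  choose! π hπ1 hπ2 hπ3 hπ4 using hπ0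
  have hemb : ∑ F ∈ Fs, φ F ^ p * σ F ≤ Cemb p := by
    refine (embedding hp hf HF.lam HF.meas HF.hσ (fun F hF => ?_) hst).trans ?_
    · exact setL_fin hp.le (ne_top_of_le_ne_top one_ne_top hf1) (HF.hσ F hF).2
    · calc _ ≤ Cemb p * 1 := by gcongr
        _ = _ := mul_one _
  -- the pieces of the operator
  set T : Set X → X → ℝ≥0∞ := fun F x =>
    ∑ Q ∈ Qs.filter (fun Q => π Q = F), Q.indicator (fun _ => μ Q ^ (s - 1) * σ Q) x with hT
  have hTm : ∀ F, Measurable (T F) := fun F =>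
    Finset.measurable_fun_sum _ fun Q hQ =>
      measurable_const.indicator (H.meas Q (Finset.mem_filter.1 hQ).1)
  set N : Set X → ℝ≥0∞ := fun F => (∫⁻ x, gF Fs g γ F x ^ r ∂u) ^ (1 / r) with hN
  have hpiece : ∀ F ∈ Fs, ∑ Q ∈ Qs.filter (fun Q => π Q = F),
      μ Q ^ (s - 1) * (∫⁻ x in Q, f x ∂σ) * (∫⁻ x in Q, g x ∂u) ≤
      2 * (φ F * (Ctest a b D L ^ b * σ F ^ (1 - a) * N F)) := by
    intro F hF
    have hgm := gF_meas HF.meas hg γ hF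
    calc _ ≤ ∑ Q ∈ Qs.filter (fun Q => π Q = F),
          2 * φ F * ((μ Q ^ (s - 1) * σ Q) * ∫⁻ x in Q, gF Fs g γ F x ∂u) := by
          refine Finset.sum_le_sum fun Q hQ => ?_
          rw [Finset.mem_filter] at hQ
          obtain ⟨hQ, rfl⟩ := hQ
          have e : ∫⁻ x in Q, f x ∂σ = φ Q * σ Q :=
            (ENNReal.div_mul_cancel (H.hσ Q hQ).1 (H.hσ Q hQ).2).symm
          have h1 : ∫⁻ x in Q, g x ∂u ≤ ∫⁻ x in Q, gF Fs g γ (π Q) x ∂u := by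
            refine gF_ge HF.lam HF.meas HF.hu hg hF (H.meas Q hQ) (hπ2 Q hQ) ?_
            intro F' hF'
            rw [mem_ch] at hF'
            rcases H.lam F' (hFs hF'.1) Q hQ with h | h | h
            · left; exact h
            · exact absurd (hπ4 Q hQ F' hF'.1 h) hF'.2.1.2
            · right; exact h
          rw [e]
          calc _ ≤ μ Q ^ (s - 1) * (2 * φ (π Q) * σ Q) * ∫⁻ x in Q, gF Fs g γ (π Q) x ∂u := by
                gcongr
                exact hπ3 Q hQ
            _ = _ := by ring
      _ = 2 * φ F * ∫⁻ x, T F x * gF Fs g γ F x ∂u := by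
          rw [← Finset.mul_sum]
          congr 1
          simp only [hT, Finset.sum_mul]
          have hmm : ∀ Q ∈ Qs.filter (fun Q => π Q = F), Measurable
              (fun x => Q.indicator (fun _ => μ Q ^ (s - 1) * σ Q) x * gF Fs g γ F x) :=
            fun Q hQ => (measurable_const.indicator
              (H.meas Q (Finset.mem_filter.1 hQ).1)).mul hgm
          rw [lintegral_finsetSum _ hmm]
          refine Finset.sum_congr rfl fun Q hQ => ?_
          have hQm := H.meas Q (Finset.mem_filter.1 hQ).1
          rw [← lintegral_const_mul _ hgm, ← lintegral_indicator hQm]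
          refine lintegral_congr fun x => ?_
          by_cases hx : x ∈ Q <;> simp [hx]
      _ ≤ 2 * φ F * ((∫⁻ x, T F x ^ (1 / b) ∂u) ^ (1 / (1 / b)) * N F) := by
          gcongr
          exact ENNReal.lintegral_mul_le_Lp_mul_Lq u hpq (hTm F).aemeasurable hgm.aemeasurable
      _ ≤ 2 * φ F * ((Ctest a b D L ^ b * σ F ^ (1 - a)) * N F) := by
          gcongr
          have := testing (H.mono (Finset.filter_subset (fun Q => π Q = F) Qs)) F (by
            intro Q hQ
            rw [Finset.mem_filter] at hQ
            rw [← hQ.2]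
            exact hπ2 Q hQ.1)
          rw [one_div_one_div]
          refine (ENNReal.rpow_le_rpow this hb.le).trans (le_of_eq ?_)
          rw [ENNReal.mul_rpow_of_nonneg _ _ hb.le, ← ENNReal.rpow_mul, div_mul_cancel₀ _ hb.ne']
      _ = _ := by ring
  have hNsum : ∑ F ∈ Fs, N F ^ r ≤ 1 + Cemb p := by
    have e : ∀ F, N F ^ r = ∫⁻ x, gF Fs g γ F x ^ r ∂u := by
      intro F
      simp only [hN]
      rw [← ENNReal.rpow_mul, one_div_mul_cancel hr0.ne', ENNReal.rpow_one]
    simp only [e]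
    calc _ ≤ ∑ F ∈ Fs, (∫⁻ x in Erem Fs F, g x ^ r ∂u + ∑ F' ∈ ch Fs F, γ F' ^ r * u F') :=
          Finset.sum_le_sum fun F hF => gF_pow HF.lam HF.meas hg γ hF hr0
      _ ≤ 1 + ∑ F ∈ Fs, γ F ^ r * u F := by
          rw [Finset.sum_add_distrib]
          refine add_le_add ?_ ?_
          · rw [← lintegral_biUnion_finset (Erem_disj HF.lam) (fun F hF => Erem_meas HF.meas hF)]
            exact (setLIntegral_le_lintegral _ _).trans hg1
          · exact ch_sum (fun F => γ F ^ r * u F)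
      _ ≤ 1 + ∑ F ∈ Fs, φ F ^ p * σ F := by
          exact add_le_add le_rfl (Finset.sum_le_sum fun F hF => hdom F (hFs hF))
      _ ≤ _ := by gcongr
  have hc : ∀ F, φ F * σ F ^ (1 - a) = (φ F ^ p * σ F) ^ (1 - a) := by
    intro F
    rw [ENNReal.mul_rpow_of_nonneg _ _ ha1.le, ← ENNReal.rpow_mul, hpdef,
      one_div_mul_cancel ha1.ne', ENNReal.rpow_one]
  calc _ = ∑ F ∈ Fs, ∑ Q ∈ Qs.filter (fun Q => π Q = F),
        μ Q ^ (s - 1) * (∫⁻ x in Q, f x ∂σ) * (∫⁻ x in Q, g x ∂u) :=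
        (Finset.sum_fiberwise_of_maps_to hπ1 _).symm
    _ ≤ ∑ F ∈ Fs, 2 * (φ F * (Ctest a b D L ^ b * σ F ^ (1 - a) * N F)) :=
        Finset.sum_le_sum hpiece
    _ = 2 * (Ctest a b D L ^ b * ∑ F ∈ Fs, (φ F ^ p * σ F) ^ (1 - a) * N F) := by
        rw [Finset.mul_sum, Finset.mul_sum]
        refine Finset.sum_congr rfl fun F _ => ?_
        rw [← hc]; ring
    _ ≤ 2 * (Ctest a b D L ^ b * ((∑ F ∈ Fs, ((φ F ^ p * σ F) ^ (1 - a)) ^ (1 / b)) ^ (1 / (1 / b)) *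
          (∑ F ∈ Fs, N F ^ r) ^ (1 / r))) := by
        gcongr
        exact ENNReal.inner_le_Lp_mul_Lq Fs _ _ hpq
    _ ≤ 2 * (Ctest a b D L ^ b * ((Cemb p ^ ((1 - a) / b)) ^ b * (1 + Cemb p) ^ (1 - b))) := by
        rw [one_div_one_div, hrdef, one_div_one_div]
        gcongr
        have : ∀ F, ((φ F ^ p * σ F) ^ (1 - a)) ^ (1 / b) = (φ F ^ p * σ F) ^ ((1 - a) / b) := by
          intro F; rw [← ENNReal.rpow_mul, mul_one_div]
        simp only [this]
        refine sum_rpow_le _ _ _ hemb ?_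
        rw [le_div_iff₀ hb]; linarith
    _ = _ := by
        unfold Cside
        rw [← ENNReal.rpow_mul, div_mul_cancel₀ _ hb.ne']

open scoped Classical in
theorem bilinear {X : Type*} [MeasurableSpace X] {μ σ u : Measure X} {a b : ℝ} {L D : ℝ≥0∞}
    {Qs : Finset (Set X)} (H : Hyp μ σ u a b L D Qs) {f g : X → ℝ≥0∞} (hf : Measurable f)
    (hg : Measurable g) (hf1 : ∫⁻ x, f x ^ (1 / (1 - a)) ∂σ ≤ 1)
    (hg1 : ∫⁻ x, g x ^ (1 / (1 - b)) ∂u ≤ 1) :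
    ∑ Q ∈ Qs, μ Q ^ ((1 - a - b) - 1) * (∫⁻ x in Q, f x ∂σ) * (∫⁻ x in Q, g x ∂u) ≤
      Cside a b D L + Cside b a D L := by
  set P : Set X → Prop := fun Q => ((∫⁻ x in Q, g x ∂u) / u Q) ^ (1 / (1 - b)) * u Q ≤
      ((∫⁻ x in Q, f x ∂σ) / σ Q) ^ (1 / (1 - a)) * σ Q with hP
  rw [← Finset.sum_filter_add_sum_filter_not Qs P]
  gcongr
  · exact one_side (H.mono (Finset.filter_subset _ _)) hf hg hf1 hg1
      (fun Q hQ => (Finset.mem_filter.1 hQ).2)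
  · refine le_trans (le_of_eq ?_) (one_side (H.symm.mono (Finset.filter_subset (fun Q => ¬ P Q) _))
      hg hf hg1 hf1 (fun Q hQ => (not_le.1 (Finset.mem_filter.1 hQ).2).le))
    refine Finset.sum_congr rfl fun Q _ => ?_
    have e : 1 - b - a = 1 - a - b := by ring
    rw [e]; ring

theorem Ctest_scale {a b : ℝ} (ha : 0 < a) (hb : 0 < b) (D L : ℝ≥0∞) :
    Ctest a b D L = Ctest a b D 1 * L ^ (1 / b + 1 / a) := by
  unfold Ctest
  have ha' : 0 ≤ 1 / a := by positivity
  have hb' : 0 ≤ 1 / b := by positivity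
  rw [ENNReal.rpow_add_of_nonneg _ _ hb' ha', ENNReal.mul_rpow_of_nonneg _ _ ha',
    ENNReal.one_rpow, mul_one]
  ring

theorem Cside_scale {a b : ℝ} (ha : 0 < a) (hb : 0 < b) (D L : ℝ≥0∞) :
    Cside a b D L = Cside a b D 1 * L ^ (1 + b / a) := by
  unfold Cside
  rw [Ctest_scale ha hb D L, ENNReal.mul_rpow_of_nonneg _ _ hb.le, ← ENNReal.rpow_mul]
  have : (1 / b + 1 / a) * b = 1 + b / a := by field_simp
  rw [this]
  ring

theorem Cemb_ne_top {p : ℝ} (hp : 1 < p) : Cemb p ≠ ⊤ := by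
  unfold Cemb
  refine ENNReal.mul_ne_top (by simp) (ENNReal.mul_ne_top (Geo_ne_top (two_rpow_neg_lt ?_)) ?_)
  · linarith
  · exact ENNReal.rpow_ne_top_of_nonneg (by linarith) (by simp)

theorem Cside_ne_top {a b : ℝ} (ha : 0 < a) (hb : 0 < b) (hab : a + b < 1) {D : ℝ≥0∞}
    (hD : D ≠ ⊤) : Cside a b D 1 ≠ ⊤ := by
  have hb1 : 0 < 1 - b := by linarith
  have ha1 : 0 < 1 - a := by linarith
  have hp : 1 < 1 / (1 - a) := by rw [lt_div_iff₀ ha1]; linarith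
  have hE := Cemb_ne_top hp
  have hG : Geo (2 ^ (-(a / (1 - b)))) ≠ ⊤ := Geo_ne_top (two_rpow_neg_lt (by positivity))
  unfold Cside Ctest
  refine ENNReal.mul_ne_top (by simp) (ENNReal.mul_ne_top ?_ (ENNReal.mul_ne_top ?_ ?_))
  · refine ENNReal.rpow_ne_top_of_nonneg hb.le (ENNReal.mul_ne_top ?_ (ENNReal.mul_ne_top ?_ ?_))
    · exact ENNReal.rpow_ne_top_of_nonneg (by positivity) (ENNReal.mul_ne_top (by simp) hD)
    · exact ENNReal.rpow_ne_top_of_nonneg (by positivity) hG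
    · simp only [ENNReal.one_rpow, mul_one]
      exact ENNReal.mul_ne_top (by simp) (ENNReal.rpow_ne_top_of_nonneg (by positivity) (by simp))
  · exact ENNReal.rpow_ne_top_of_nonneg ha1.le hE
  · exact ENNReal.rpow_ne_top_of_nonneg hb1.le (ENNReal.add_ne_top.2 ⟨by simp, hE⟩)

/-- dyadic operator attached to a finite family -/
def hop {X : Type*} [MeasurableSpace X] (μ σ : Measure X) (t : ℝ) (Qs : Finset (Set X))
    (f : X → ℝ≥0∞) (x : X) : ℝ≥0∞ :=
  ∑ Q ∈ Qs, Q.indicator (fun _ => μ Q ^ t * ∫⁻ y in Q, f y ∂σ) x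

theorem hop_meas {X : Type*} [MeasurableSpace X] {μ σ : Measure X} {t : ℝ} {Qs : Finset (Set X)}
    (h : ∀ Q ∈ Qs, MeasurableSet Q) (f : X → ℝ≥0∞) : Measurable (hop μ σ t Qs f) :=
  Finset.measurable_fun_sum _ fun Q hQ => measurable_const.indicator (h Q hQ)

theorem dual_unit {X : Type*} [MeasurableSpace X] {μ σ u : Measure X} {a b : ℝ} {L D : ℝ≥0∞}
    {Qs : Finset (Set X)} (H : Hyp μ σ u a b L D Qs) {f : X → ℝ≥0∞} (hf : Measurable f)
    (hf1 : ∫⁻ x, f x ^ (1 / (1 - a)) ∂σ ≤ 1) :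
    (∫⁻ x, hop μ σ ((1 - a - b) - 1) Qs f x ^ (1 / b) ∂u) ^ b ≤
      Cside a b D L + Cside b a D L := by
  have ha := H.ha
  have hb := H.hb
  have hab := H.hab
  have ha1 : 0 < 1 - a := by linarith
  have hb1 : 0 < 1 - b := by linarith
  have hp : 1 < 1 / (1 - a) := by rw [lt_div_iff₀ ha1]; linarith
  set t := (1 - a - b) - 1 with ht
  set h := hop μ σ t Qs f with hh
  have hm : Measurable h := hop_meas H.meas f
  set A := ∫⁻ x, h x ^ (1 / b) ∂u with hA
  have hb0 : 0 < 1 / b := by positivity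
  by_cases hA0 : A = 0
  · rw [hA0, ENNReal.zero_rpow_of_pos hb]; exact zero_le
  have hAt : A ≠ ⊤ := by
    set M := ∑ Q ∈ Qs, μ Q ^ t * ∫⁻ y in Q, f y ∂σ with hM
    have hMt : M ≠ ⊤ := by
      refine ENNReal.sum_ne_top.2 fun Q hQ => ENNReal.mul_ne_top ?_ ?_
      · exact ENNReal.rpow_ne_top_of_ne_zero (H.hμ Q hQ).1 (H.hμ Q hQ).2
      · exact setL_fin hp.le (ne_top_of_le_ne_top one_ne_top hf1) (H.hσ Q hQ).2
    set U := ⋃ Q ∈ Qs, Q with hU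
    have hUm : MeasurableSet U := Finset.measurableSet_biUnion _ H.meas
    have hUt : u U ≠ ⊤ :=
      ((measure_biUnion_finset_le Qs _).trans_lt
        (ENNReal.sum_lt_top.2 fun Q hQ => (H.hu Q hQ).2.lt_top)).ne
    have hle : A ≤ ∫⁻ x, U.indicator (fun _ => M ^ (1 / b)) x ∂u := by
      refine lintegral_mono fun x => ?_
      by_cases hx : x ∈ U
      · rw [indicator_of_mem hx]
        refine ENNReal.rpow_le_rpow (Finset.sum_le_sum fun Q hQ => ?_) hb0.le
        exact indicator_le_self _ _ _
      · have : h x = 0 := by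
          refine Finset.sum_eq_zero fun Q hQ => indicator_of_notMem (fun hxQ => hx ?_) _
          exact mem_iUnion₂.2 ⟨Q, hQ, hxQ⟩
        rw [this, ENNReal.zero_rpow_of_pos hb0]; exact zero_le
    rw [lintegral_indicator hUm, lintegral_const, Measure.restrict_apply_univ] at hle
    exact ne_top_of_le_ne_top (ENNReal.mul_ne_top
      (ENNReal.rpow_ne_top_of_nonneg hb0.le hMt) hUt) hle
  have hAp0 : A ^ (1 - b) ≠ 0 := by simp [hA0, hAt]
  have hApt : A ^ (1 - b) ≠ ⊤ := ENNReal.rpow_ne_top_of_nonneg hb1.le hAt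
  have e1 : 0 ≤ 1 / b - 1 := by
    have : 1 ≤ 1 / b := by rw [le_div_iff₀ hb]; linarith
    linarith
  set g : X → ℝ≥0∞ := fun x => h x ^ (1 / b - 1) / A ^ (1 - b) with hg
  have hgm : Measurable g := (hm.pow_const _).div_const _
  have hg1 : ∫⁻ x, g x ^ (1 / (1 - b)) ∂u ≤ 1 := by
    have : ∀ x, g x ^ (1 / (1 - b)) = h x ^ (1 / b) * A⁻¹ := by
      intro x
      simp only [hg]
      rw [ENNReal.div_rpow_of_nonneg _ _ (by positivity), ← ENNReal.rpow_mul, ← ENNReal.rpow_mul,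
        mul_one_div_cancel hb1.ne', ENNReal.rpow_one, div_eq_mul_inv]
      congr 2
      field_simp
    simp only [this]
    rw [lintegral_mul_const _ (hm.pow_const _), ENNReal.mul_inv_cancel hA0 hAt]
  have key := bilinear H hf hgm hf1 hg1
  refine le_trans (le_of_eq ?_) key
  have e2 : ∑ Q ∈ Qs, μ Q ^ t * (∫⁻ x in Q, f x ∂σ) * (∫⁻ x in Q, g x ∂u) =
      ∫⁻ x, h x * g x ∂u := by
    have : ∀ x, h x * g x = ∑ Q ∈ Qs, Q.indicator (fun _ => μ Q ^ t * ∫⁻ y in Q, f y ∂σ) x * g x := by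
      intro x; simp only [hh, hop, Finset.sum_mul]
    simp only [this]
    have hmm : ∀ Q ∈ Qs, Measurable
        (fun x => Q.indicator (fun _ => μ Q ^ t * ∫⁻ y in Q, f y ∂σ) x * g x) :=
      fun Q hQ => (measurable_const.indicator (H.meas Q hQ)).mul hgm
    rw [lintegral_finsetSum _ hmm]
    refine Finset.sum_congr rfl fun Q hQ => ?_
    rw [← lintegral_const_mul _ hgm, ← lintegral_indicator (H.meas Q hQ)]
    refine lintegral_congr fun x => ?_
    by_cases hx : x ∈ Q <;> simp [hx]
  rw [← ht, e2]
  have e3 : ∀ x, h x * g x = h x ^ (1 / b) * (A ^ (1 - b))⁻¹ := by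
    intro x
    simp only [hg]
    rw [div_eq_mul_inv, ← mul_assoc]
    congr 1
    calc _ = h x ^ (1:ℝ) * h x ^ (1 / b - 1) := by rw [ENNReal.rpow_one]
      _ = _ := by rw [← ENNReal.rpow_add_of_nonneg _ _ zero_le_one e1]; congr 1; ring
  simp only [e3]
  rw [lintegral_mul_const _ (hm.pow_const _), ← div_eq_mul_inv, ENNReal.eq_div_iff hAp0 hApt,
    ← ENNReal.rpow_add _ _ hA0 hAt]
  simp [hA]

theorem dual {X : Type*} [MeasurableSpace X] {μ σ u : Measure X} {a b : ℝ} {L D C : ℝ≥0∞}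
    {Qs : Finset (Set X)} (H : Hyp μ σ u a b L D Qs) {f : X → ℝ≥0∞} (hf : Measurable f)
    (hC : Cside a b D L + Cside b a D L ≤ C) (hC0 : C ≠ 0) :
    (∫⁻ x, hop μ σ ((1 - a - b) - 1) Qs f x ^ (1 / b) ∂u) ^ b ≤
      C * (∫⁻ x, f x ^ (1 / (1 - a)) ∂σ) ^ (1 - a) := by
  have ha := H.ha
  have hb := H.hb
  have hab := H.hab
  have ha1 : 0 < 1 - a := by linarith
  have hb0 : 0 < 1 / b := by positivity
  set t := (1 - a - b) - 1 with ht
  set I := ∫⁻ x, f x ^ (1 / (1 - a)) ∂σ with hI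
  by_cases hI0 : I = 0
  · rw [hI, lintegral_eq_zero_iff (hf.pow_const _)] at hI0
    have hz : ∀ Q : Set X, ∫⁻ y in Q, f y ∂σ = 0 := by
      intro Q
      rw [lintegral_eq_zero_iff hf]
      refine ae_restrict_of_ae ?_
      filter_upwards [hI0] with x hx
      simp only [Pi.zero_apply] at hx ⊢
      rcases ENNReal.rpow_eq_zero_iff.1 hx with h | h
      · exact h.1
      · exact absurd h.2 (not_lt.2 (by positivity))
    have : ∀ x, hop μ σ t Qs f x = 0 := by
      intro x; simp [hop, hz]
    simp only [this, ENNReal.zero_rpow_of_pos hb0, lintegral_const, zero_mul,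
      ENNReal.zero_rpow_of_pos hb]
    exact zero_le
  by_cases hIt : I = ⊤
  · rw [hIt, ENNReal.top_rpow_of_pos ha1, ENNReal.mul_top hC0]; exact le_top
  set N := I ^ (1 - a) with hN
  have hN0 : N ≠ 0 := by simp [hN, hI0, hIt]
  have hNt : N ≠ ⊤ := ENNReal.rpow_ne_top_of_nonneg ha1.le hIt
  have key := dual_unit (f := fun x => N⁻¹ * f x) H (hf.const_mul _) (by
    have : ∀ x, (N⁻¹ * f x) ^ (1 / (1 - a)) = I⁻¹ * f x ^ (1 / (1 - a)) := by
      intro x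
      rw [ENNReal.mul_rpow_of_nonneg _ _ (by positivity), hN, ← ENNReal.rpow_neg,
        ← ENNReal.rpow_mul, neg_mul, mul_one_div_cancel ha1.ne', ENNReal.rpow_neg_one]
    simp only [this]
    rw [lintegral_const_mul _ (hf.pow_const _), ENNReal.inv_mul_cancel hI0 hIt])
  have e : ∀ x, hop μ σ t Qs (fun x => N⁻¹ * f x) x = N⁻¹ * hop μ σ t Qs f x := by
    intro x
    simp only [hop, Finset.mul_sum]
    refine Finset.sum_congr rfl fun Q hQ => ?_
    rw [lintegral_const_mul _ hf]
    by_cases hx : x ∈ Q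
    · simp only [hx, indicator_of_mem]; ring
    · simp [hx]
  rw [← ht] at key
  simp only [e] at key
  have e2 : ∀ x, (N⁻¹ * hop μ σ t Qs f x) ^ (1 / b) = (N⁻¹) ^ (1 / b) * hop μ σ t Qs f x ^ (1 / b) :=
    fun x => ENNReal.mul_rpow_of_nonneg _ _ hb0.le
  simp only [e2] at key
  rw [lintegral_const_mul _ ((hop_meas H.meas f).pow_const _),
    ENNReal.mul_rpow_of_nonneg _ _ hb.le, ← ENNReal.rpow_mul, one_div_mul_cancel hb.ne',
    ENNReal.rpow_one] at key
  have k2 := mul_le_mul_left (key.trans hC) N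
  calc _ = (N⁻¹ * (∫⁻ x, hop μ σ t Qs f x ^ (1 / b) ∂u) ^ b) * N := by
        rw [mul_comm, ← mul_assoc, ENNReal.mul_inv_cancel hN0 hNt, one_mul]
    _ ≤ _ := k2

/-- shift of the grid -/
def shf (c : Bool) : ℝ := if c then 1 / 3 else 0

/-- rescaled and shifted coordinate -/
def yv (c : Bool) (k : ℤ) (x : ℝ) : ℝ := 2 ^ k * x + (-1) ^ k * shf c

theorem sgn_cases (k : ℤ) : ((-1 : ℝ) ^ k = 1) ∨ ((-1 : ℝ) ^ k = -1) := by
  rcases Int.even_or_odd k with h | h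
  · left; exact h.neg_one_zpow
  · right; exact h.neg_one_zpow

theorem yv_step (c : Bool) (k : ℤ) : ∃ z : ℤ, ∀ x, ⌊yv c k x⌋ = (⌊yv c (k + 1) x⌋ + z) / 2 := by
  have h : ∃ z : ℤ, ∀ x, yv c k x = (yv c (k + 1) x + z) / (2 : ℕ) := by
    have e1 : (2:ℝ) ^ (k + 1) = 2 ^ k * 2 := zpow_add_one₀ two_ne_zero k
    have e2 : (-1:ℝ) ^ (k + 1) = - (-1) ^ k := by rw [zpow_add_one₀ (by norm_num)]; ring
    cases c
    · refine ⟨0, fun x => ?_⟩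
      simp only [yv, shf, e1, e2]
      push_cast
      simp
      ring
    · rcases sgn_cases k with hk | hk
      · refine ⟨1, fun x => ?_⟩
        simp only [yv, shf, e1, e2, hk]
        push_cast
        simp
        ring
      · refine ⟨-1, fun x => ?_⟩
        simp only [yv, shf, e1, e2, hk]
        push_cast
        simp
        ring
  obtain ⟨z, hz⟩ := h
  refine ⟨z, fun x => ?_⟩
  rw [hz, Int.floor_div_natCast, Int.floor_add_intCast]
  rfl

theorem yv_det (c : Bool) (k : ℤ) (x y : ℝ) (j : ℕ)
    (h : ⌊yv c (k + j) x⌋ = ⌊yv c (k + j) y⌋) : ⌊yv c k x⌋ = ⌊yv c k y⌋ := by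
  induction j with
  | zero => simpa using h
  | succ j ih =>
    apply ih
    obtain ⟨z, hz⟩ := yv_step c (k + j)
    have e : k + ((j + 1 : ℕ) : ℤ) = k + j + 1 := by push_cast; ring
    rw [e] at h
    rw [hz x, hz y, h]

theorem third_trick (k : ℤ) (x y : ℝ) (h : |2 ^ k * x - 2 ^ k * y| < 1 / 3) :
    ∃ c, ⌊yv c k x⌋ = ⌊yv c k y⌋ := by
  wlog hxy : x ≤ y generalizing x y with H
  · obtain ⟨c, hc⟩ := H y x (by rw [abs_sub_comm]; exact h) (le_of_not_ge hxy)
    exact ⟨c, hc.symm⟩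
  have hk : (0:ℝ) < 2 ^ k := by positivity
  have hXY : (2:ℝ) ^ k * x ≤ 2 ^ k * y := by gcongr
  set X := (2:ℝ) ^ k * x with hX
  set Y := (2:ℝ) ^ k * y with hY
  rw [abs_lt] at h
  by_cases hf : ⌊X⌋ = ⌊Y⌋
  · refine ⟨false, ?_⟩
    simp only [yv, shf]
    simpa using hf
  · refine ⟨true, ?_⟩
    have h1 := Int.floor_le Y
    have h2 := Int.lt_floor_add_one Y
    have h3 : X < ⌊Y⌋ := by
      by_contra hc
      push Not at hc
      apply hf
      rw [Int.floor_eq_iff]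
      exact ⟨hc, by linarith⟩
    simp only [yv, shf, ← hX, ← hY]
    rcases sgn_cases k with hs | hs
    · rw [hs]
      have e1 : ⌊X + 1 * (if true then 1 / 3 else 0)⌋ = ⌊Y⌋ := by
        rw [Int.floor_eq_iff]; simp; constructor <;> linarith
      have e2 : ⌊Y + 1 * (if true then 1 / 3 else 0)⌋ = ⌊Y⌋ := by
        rw [Int.floor_eq_iff]; simp; constructor <;> linarith
      exact e1.trans e2.symm
    · rw [hs]
      have e1 : ⌊X + -1 * (if true then 1 / 3 else 0)⌋ = ⌊Y⌋ - 1 := by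
        rw [Int.floor_eq_iff]; push_cast; simp; constructor <;> linarith
      have e2 : ⌊Y + -1 * (if true then 1 / 3 else 0)⌋ = ⌊Y⌋ - 1 := by
        rw [Int.floor_eq_iff]; push_cast; simp; constructor <;> linarith
      exact e1.trans e2.symm

/-- cells of the shifted dyadic grid -/
def cell {n : ℕ} (t : Fin n → Bool) (k : ℤ) (m : Fin n → ℤ) : Set (Euc n) :=
  {x | ∀ i, ⌊yv (t i) k (x i)⌋ = m i}

/-- lower corner of a cell -/
def corner {n : ℕ} (t : Fin n → Bool) (k : ℤ) (m : Fin n → ℤ) (i : Fin n) : ℝ :=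
  2 ^ (-k) * (m i - (-1) ^ k * shf (t i))

theorem mem_cell_iff {n : ℕ} (t : Fin n → Bool) (k : ℤ) (m : Fin n → ℤ) (x : Euc n) :
    x ∈ cell t k m ↔ ∀ i, x i ∈ Ico (corner t k m i) (corner t k m i + 2 ^ (-k)) := by
  refine forall_congr' fun i => ?_
  have hk : (0:ℝ) < 2 ^ k := by positivity
  rw [Int.floor_eq_iff, mem_Ico]
  unfold yv corner
  rw [zpow_neg]
  set A : ℝ := 2 ^ k
  set B : ℝ := (-1) ^ k * shf (t i)
  have e : A⁻¹ * ((m i : ℝ) - B) + A⁻¹ = A⁻¹ * (m i + 1 - B) := by ring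
  rw [e, inv_mul_le_iff₀ hk, lt_inv_mul_iff₀ hk]
  constructor <;> rintro ⟨h1, h2⟩ <;> constructor <;> linarith

theorem cell_eq {n : ℕ} (t : Fin n → Bool) (k : ℤ) (m : Fin n → ℤ) :
    cell t k m = (@WithLp.ofLp 2 (Fin n → ℝ)) ⁻¹'
      (Set.univ.pi fun i => Ico (corner t k m i) (corner t k m i + 2 ^ (-k))) := by
  ext x
  rw [mem_cell_iff]
  simp

theorem cell_meas {n : ℕ} (t : Fin n → Bool) (k : ℤ) (m : Fin n → ℤ) :
    MeasurableSet (cell t k m) := by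
  rw [cell_eq]
  exact (PiLp.volume_preserving_ofLp (Fin n)).measurable
    (MeasurableSet.univ_pi fun i => measurableSet_Ico)

theorem cell_vol {n : ℕ} (t : Fin n → Bool) (k : ℤ) (m : Fin n → ℤ) :
    volume (cell t k m) = ENNReal.ofReal (2 ^ (-k)) ^ n := by
  rw [cell_eq, (PiLp.volume_preserving_ofLp (Fin n)).measure_preimage
    (MeasurableSet.univ_pi fun i => measurableSet_Ico).nullMeasurableSet, volume_pi_pi]
  simp

theorem Cube_eq {n : ℕ} (a : Euc n) (h : ℝ) :
    Cube a h = (@WithLp.ofLp 2 (Fin n → ℝ)) ⁻¹'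
      (Set.univ.pi fun i => Icc (a i) (a i + h)) := by
  ext x
  simp only [Cube, mem_preimage, mem_univ_pi, mem_Icc, mem_setOf_eq]

theorem Cube_meas {n : ℕ} (a : Euc n) (h : ℝ) : MeasurableSet (Cube a h) := by
  rw [Cube_eq]
  exact (PiLp.volume_preserving_ofLp (Fin n)).measurable
    (MeasurableSet.univ_pi fun i => measurableSet_Icc)

theorem Cube_vol {n : ℕ} (a : Euc n) (h : ℝ) : volume (Cube a h) = ENNReal.ofReal h ^ n := by
  rw [Cube_eq, (PiLp.volume_preserving_ofLp (Fin n)).measure_preimage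
    (MeasurableSet.univ_pi fun i => measurableSet_Icc).nullMeasurableSet, volume_pi_pi]
  simp

theorem cell_sub_Cube {n : ℕ} (t : Fin n → Bool) (k : ℤ) (m : Fin n → ℤ) :
    cell t k m ⊆ Cube (WithLp.toLp 2 (corner t k m)) (2 ^ (-k)) := by
  intro x hx i
  rw [mem_cell_iff] at hx
  exact ⟨(hx i).1, (hx i).2.le⟩

theorem cell_nested {n : ℕ} (t : Fin n → Bool) {k l : ℤ} (hkl : k ≤ l) (m m' : Fin n → ℤ)
    {x : Euc n} (hx : x ∈ cell t k m) (hx' : x ∈ cell t l m') : cell t l m' ⊆ cell t k m := by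
  obtain ⟨j, rfl⟩ := Int.le.dest hkl
  intro y hy i
  rw [← hx i]
  exact yv_det (t i) k (y i) (x i) j ((hy i).trans (hx' i).symm)

/-- the shifted dyadic grid -/
def grid {n : ℕ} (t : Fin n → Bool) : Set (Set (Euc n)) :=
  range fun km : ℤ × (Fin n → ℤ) => cell t km.1 km.2

theorem grid_countable {n : ℕ} (t : Fin n → Bool) : (grid t).Countable := countable_range _

theorem grid_lam {n : ℕ} (t : Fin n → Bool) (Qs : Finset (Set (Euc n)))
    (h : ∀ Q ∈ Qs, Q ∈ grid t) : Lam Qs := by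
  intro P hP Q hQ
  obtain ⟨⟨k, m⟩, rfl⟩ := h P hP
  obtain ⟨⟨l, m'⟩, rfl⟩ := h Q hQ
  by_cases hd : Disjoint (cell t k m) (cell t l m')
  · exact Or.inr (Or.inr hd)
  · rw [not_disjoint_iff] at hd
    obtain ⟨x, hx, hx'⟩ := hd
    rcases le_total k l with hkl | hkl
    · exact Or.inr (Or.inl (cell_nested t hkl m m' hx hx'))
    · exact Or.inl (cell_nested t hkl m' m hx' hx)

theorem cell_vol_rpow {n : ℕ} (t : Fin n → Bool) (k : ℤ) (m : Fin n → ℤ) (r : ℝ) :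
    volume (cell t k m) ^ r = ENNReal.ofReal (((2:ℝ) ^ (-k)) ^ (n * r)) := by
  rw [cell_vol, ← ENNReal.rpow_natCast, ← ENNReal.rpow_mul, ENNReal.ofReal_rpow_of_pos (by positivity)]

theorem grid_tower {n : ℕ} (hn : 0 < n) (t : Fin n → Bool) {s : ℝ} (hs : 0 < s) (x : Euc n)
    (Ts : Finset (Set (Euc n))) (R : Set (Euc n)) (hT : ∀ Q ∈ Ts, Q ∈ grid t)
    (h : ∀ Q ∈ Ts, x ∈ Q ∧ Q ⊆ R) :
    ∑ Q ∈ Ts, volume Q ^ s ≤ Geo (2 ^ (-(n * s))) * volume R ^ s := by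
  have hns : 0 < (n:ℝ) * s := by positivity
  refine geo_sum _ _ (Geo_spec (two_rpow_neg_lt hns)) _ Ts _ ?_ ?_
  · intro Q hQ
    exact ENNReal.rpow_le_rpow (measure_mono (h Q hQ).2) hs.le
  · have key : ∀ (k l : ℤ) (m m' : Fin n → ℤ), k < l → volume (cell t l m') ^ s ≤
        2 ^ (-(n * s)) * volume (cell t k m) ^ s := by
      intro k l m m' hkl
      have e2 : (2:ℝ≥0∞) ^ (-(n * s)) = ENNReal.ofReal ((2:ℝ) ^ (-(n * s))) := by
        rw [← ENNReal.ofReal_rpow_of_pos (by norm_num)]; simp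
      rw [cell_vol_rpow, cell_vol_rpow, e2, ← ENNReal.ofReal_mul (by positivity)]
      apply ENNReal.ofReal_le_ofReal
      have e3 : (2:ℝ) ^ (-(n * s)) = (2⁻¹ : ℝ) ^ (n * s) := by
        rw [Real.rpow_neg (by norm_num), Real.inv_rpow (by norm_num)]
      rw [e3, ← Real.mul_rpow (by positivity) (by positivity)]
      refine Real.rpow_le_rpow (by positivity) ?_ hns.le
      have : (2⁻¹:ℝ) * 2 ^ (-k) = 2 ^ (-k - 1) := by
        rw [zpow_sub_one₀ two_ne_zero]; ring
      rw [this]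
      exact zpow_le_zpow_right₀ (by norm_num) (by omega)
    intro P hP Q hQ hne
    have hxP := (h P hP).1
    have hxQ := (h Q hQ).1
    obtain ⟨⟨k, m⟩, rfl⟩ := hT P hP
    obtain ⟨⟨l, m'⟩, rfl⟩ := hT Q hQ
    simp only at *
    rcases lt_trichotomy k l with hkl | hkl | hkl
    · right; exact key k l m m' hkl
    · subst hkl
      exact absurd (Subset.antisymm (cell_nested t le_rfl m' m hxQ hxP)
        (cell_nested t le_rfl m m' hxP hxQ)) hne
    · left; exact key l k m' m hkl

theorem kernel_bound {n : ℕ} (hn : 0 < n) {α : ℝ} (hαn : α < n) (x y : Euc n) :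
    ENNReal.ofReal (‖x - y‖ ^ (α - (n:ℝ))) ≤ ENNReal.ofReal (6 ^ ((n:ℝ) - α)) *
      ∑ t : Fin n → Bool, ∑' Q : grid t, volume (Q : Set (Euc n)) ^ (α / n - 1) *
        ((Q : Set (Euc n)).indicator 1 x * (Q : Set (Euc n)).indicator 1 y) := by
  have hn' : (0:ℝ) < n := by exact_mod_cast hn
  by_cases hxy : x = y
  · subst hxy
    rw [sub_self, norm_zero, Real.zero_rpow (by linarith), ENNReal.ofReal_zero]
    exact zero_le
  have hd : 0 < ‖x - y‖ := norm_pos_iff.2 (sub_ne_zero.2 hxy)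
  set d := ‖x - y‖
  obtain ⟨j, hj1, hj2⟩ := exists_mem_Ico_zpow (by positivity : 0 < 3 * d) (one_lt_two : (1:ℝ) < 2)
  set k : ℤ := -(j + 1) with hk
  have hk0 : (0:ℝ) < 2 ^ k := by positivity
  have h1 : (3:ℝ) * d < 2 ^ (-k) := by rw [hk, neg_neg]; exact hj2
  have h2 : (2:ℝ) ^ (-k) ≤ 6 * d := by
    rw [hk, neg_neg, zpow_add_one₀ two_ne_zero]; linarith
  have h3 : ∀ i, ∃ c, ⌊yv c k (x i)⌋ = ⌊yv c k (y i)⌋ := by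
    intro i
    apply third_trick
    rw [← mul_sub, abs_mul, abs_of_pos hk0]
    have h4 : |x i - y i| ≤ d := by
      have := PiLp.norm_apply_le (x - y) i
      simpa [Real.norm_eq_abs] using this
    rw [zpow_neg, lt_inv_comm₀ (by positivity) hk0] at h1
    calc (2:ℝ) ^ k * |x i - y i| ≤ 2 ^ k * d := by gcongr
      _ < (3 * d)⁻¹ * d := by gcongr
      _ = 1 / 3 := by field_simp
  choose t ht using h3
  set m : Fin n → ℤ := fun i => ⌊yv (t i) k (x i)⌋ with hm
  have hxc : x ∈ cell t k m := fun i => rfl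
  have hyc : y ∈ cell t k m := fun i => (ht i).symm
  let Q : grid t := ⟨cell t k m, ⟨(k, m), rfl⟩⟩
  calc ENNReal.ofReal (d ^ (α - (n:ℝ)))
      ≤ ENNReal.ofReal (6 ^ ((n:ℝ) - α)) * volume (cell t k m) ^ (α / n - 1) := by
        rw [cell_vol_rpow, ← ENNReal.ofReal_mul (by positivity)]
        apply ENNReal.ofReal_le_ofReal
        have e : (n:ℝ) * (α / n - 1) = α - n := by field_simp
        have e' : (n:ℝ) - α = -(α - n) := by ring
        rw [e, e', Real.rpow_neg (by norm_num)]
        have h5 : (6 * d) ^ (α - n) ≤ ((2:ℝ) ^ (-k)) ^ (α - n) :=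
          Real.rpow_le_rpow_of_nonpos (by positivity) h2 (by linarith)
        rw [Real.mul_rpow (by norm_num) hd.le] at h5
        rwa [le_inv_mul_iff₀ (by positivity)]
    _ = ENNReal.ofReal (6 ^ ((n:ℝ) - α)) * (volume (Q : Set (Euc n)) ^ (α / n - 1) *
        ((Q : Set (Euc n)).indicator 1 x * (Q : Set (Euc n)).indicator 1 y)) := by
        have : (Q : Set (Euc n)) = cell t k m := rfl
        rw [this, indicator_of_mem hxc, indicator_of_mem hyc]
        simp
    _ ≤ _ := by
        gcongr
        refine le_trans ?_ (Finset.single_le_sum (fun _ _ => zero_le) (Finset.mem_univ t))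
        exact ENNReal.le_tsum Q

theorem Apq_cube {n : ℕ} {p q : ℝ} (hp : 1 < p) (w : Euc n → ℝ) (c : Euc n) {h : ℝ} (hh : 0 < h) :
    ((volume (Cube c h))⁻¹ * ∫⁻ x in Cube c h, ENNReal.ofReal (w x) ^ q) *
      ((volume (Cube c h))⁻¹ * ∫⁻ x in Cube c h,
            ENNReal.ofReal (w x) ^ (-(dualExp p))) ^ (q / dualExp p) ≤ Apq p q w := by
  unfold Apq
  refine le_iSup_of_le c (le_iSup_of_le h (le_iSup_of_le hh ?_))
  rw [if_neg hp.ne']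

theorem Cube_vol_ne {n : ℕ} (c : Euc n) {h : ℝ} (hh : 0 < h) :
    volume (Cube c h) ≠ 0 ∧ volume (Cube c h) ≠ ⊤ := by
  rw [Cube_vol]
  constructor
  · exact pow_ne_zero _ (by simpa using hh)
  · exact ENNReal.pow_ne_top (by simp)

theorem dualExp_pos {p : ℝ} (hp : 1 < p) : 0 < dualExp p := by
  unfold dualExp
  have : 0 < p - 1 := by linarith
  positivity

/-- the cubes centred around a corner exhaust the space -/
theorem exhaust {n : ℕ} {P : Euc n → Prop} (c : Euc n) {h : ℝ} (hh : 0 < h)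
    (H : ∀ N : ℕ, ∀ᵐ x ∂volume, x ∈ Cube (WithLp.toLp 2 (fun i => c i - N)) (h + 2 * N) → P x) :
    ∀ᵐ x ∂(volume : Measure (Euc n)), P x := by
  rw [← ae_all_iff] at H
  filter_upwards [H] with x hx
  obtain ⟨N, hN⟩ := exists_nat_ge ‖x - c‖
  refine hx N fun i => ?_
  have h4 : |x i - c i| ≤ ‖x - c‖ := by
    have := PiLp.norm_apply_le (x - c) i
    simpa [Real.norm_eq_abs] using this
  have h5 := abs_le.1 (h4.trans hN)
  constructor
  · show c i - N ≤ x i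
    linarith [h5.1]
  · show x i ≤ c i - N + (h + 2 * N)
    linarith [h5.2]

theorem Cube_sub {n : ℕ} (c : Euc n) {h : ℝ} (N : ℕ) :
    Cube c h ⊆ Cube (WithLp.toLp 2 (fun i => c i - N)) (h + 2 * N) := by
  intro x hx i
  have hN : (0:ℝ) ≤ N := Nat.cast_nonneg _
  constructor
  · show c i - N ≤ x i
    linarith [(hx i).1]
  · show x i ≤ c i - N + (h + 2 * N)
    linarith [(hx i).2]

theorem sigma_fin {n : ℕ} {p q : ℝ} (hp : 1 < p) (hq : 0 < q) {w : Euc n → ℝ} (hw : Measurable w)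
    (hA : Apq p q w < ⊤) (hne : ¬ ∀ᵐ x ∂(volume : Measure (Euc n)), ENNReal.ofReal (w x) = 0)
    (c : Euc n) {h : ℝ} (hh : 0 < h) :
    ∫⁻ x in Cube c h, ENNReal.ofReal (w x) ^ (-(dualExp p)) ≠ ⊤ := by
  intro htop
  apply hne
  refine exhaust c hh fun N => ?_
  have hN : (0:ℝ) ≤ N := Nat.cast_nonneg _
  have hh' : 0 < h + 2 * N := by positivity
  set c' : Euc n := WithLp.toLp 2 (fun i => c i - N) with hc'
  have h1 := (Apq_cube (q := q) hp w c' hh').trans_lt hA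
  have h2 : ∫⁻ x in Cube c' (h + 2 * N), ENNReal.ofReal (w x) ^ (-(dualExp p)) = ⊤ :=
    top_le_iff.1 (htop ▸ lintegral_mono_set (Cube_sub c N))
  obtain ⟨v0, vt⟩ := Cube_vol_ne c' hh'
  rw [h2, ENNReal.mul_top (by simpa using vt),
    ENNReal.top_rpow_of_pos (div_pos hq (dualExp_pos hp))] at h1
  have h3 : ∫⁻ x in Cube c' (h + 2 * N), ENNReal.ofReal (w x) ^ q = 0 := by
    by_contra h0
    rw [ENNReal.mul_top (mul_ne_zero (by simpa using vt) h0)] at h1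
    exact lt_irrefl _ h1
  rw [lintegral_eq_zero_iff (hw.ennreal_ofReal.pow_const _)] at h3
  rw [Filter.EventuallyEq, ae_restrict_iff' (Cube_meas _ _)] at h3
  filter_upwards [h3] with x hx hxc
  have := hx hxc
  simp only [Pi.zero_apply] at this
  rcases ENNReal.rpow_eq_zero_iff.1 this with h | h
  · exact h.1
  · exact absurd h.2 (not_lt.2 hq.le)

theorem w_pos {n : ℕ} {p q : ℝ} (hp : 1 < p) (hq : 0 < q) {w : Euc n → ℝ} (hw : Measurable w)
    (hA : Apq p q w < ⊤) (hne : ¬ ∀ᵐ x ∂(volume : Measure (Euc n)), ENNReal.ofReal (w x) = 0) :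
    ∀ᵐ x ∂(volume : Measure (Euc n)), ENNReal.ofReal (w x) ≠ 0 := by
  refine exhaust 0 one_pos fun N => ?_
  have hN : (0:ℝ) ≤ N := Nat.cast_nonneg _
  have h1 := ae_lt_top (hw.ennreal_ofReal.pow_const _) (sigma_fin hp hq hw hA hne
    (WithLp.toLp 2 (fun i => (0 : Euc n) i - N)) (by positivity : 0 < 1 + 2 * (N:ℝ)))
  rw [ae_restrict_iff' (Cube_meas _ _)] at h1
  filter_upwards [h1] with x hx hxc h0
  have := hx hxc
  rw [h0, ENNReal.zero_rpow_of_neg (by linarith [dualExp_pos hp])] at this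
  exact lt_irrefl _ this

theorem u_fin {n : ℕ} {p q : ℝ} (hp : 1 < p) (hq : 0 < q) {w : Euc n → ℝ} (hw : Measurable w)
    (hA : Apq p q w < ⊤) (c : Euc n) {h : ℝ} (hh : 0 < h) :
    ∫⁻ x in Cube c h, ENNReal.ofReal (w x) ^ q ≠ ⊤ := by
  intro htop
  obtain ⟨v0, vt⟩ := Cube_vol_ne c hh
  have h1 := (Apq_cube (q := q) hp w c hh).trans_lt hA
  rw [htop, ENNReal.mul_top (by simpa using vt)] at h1
  have h2 : ((volume (Cube c h))⁻¹ * ∫⁻ x in Cube c h,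
            ENNReal.ofReal (w x) ^ (-(dualExp p))) ^ (q / dualExp p) = 0 := by
    by_contra h0
    rw [ENNReal.top_mul h0] at h1
    exact lt_irrefl _ h1
  have h3 : ∫⁻ x in Cube c h, ENNReal.ofReal (w x) ^ (-(dualExp p)) = 0 := by
    rcases ENNReal.rpow_eq_zero_iff.1 h2 with h | h
    · rcases mul_eq_zero.1 h.1 with h | h
      · exact absurd h (by simpa using vt)
      · exact h
    · exact absurd h.2 (not_lt.2 (div_pos hq (dualExp_pos hp)).le)
  rw [lintegral_eq_zero_iff (hw.ennreal_ofReal.pow_const _)] at h3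
  have h4 : ∀ᵐ x ∂(volume.restrict (Cube c h)), False := by
    filter_upwards [h3] with x hx
    simp only [Pi.zero_apply] at hx
    rcases ENNReal.rpow_eq_zero_iff.1 hx with h | h
    · linarith [h.2, dualExp_pos hp]
    · exact absurd h.1 (by simp)
  rw [Filter.eventually_false_iff_eq_bot, ae_eq_bot, Measure.restrict_eq_zero] at h4
  exact v0 h4

/-- weighted measure with a power of `w` as density -/
def wden {n : ℕ} (w : Euc n → ℝ) (r : ℝ) : Measure (Euc n) :=
  volume.withDensity (fun x => ENNReal.ofReal (w x) ^ r)

theorem wden_ne_zero {n : ℕ} {w : Euc n → ℝ} (hw : Measurable w) (r : ℝ)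
    (hpos : ∀ᵐ x ∂(volume : Measure (Euc n)), ENNReal.ofReal (w x) ≠ 0) {E : Set (Euc n)}
    (hE : MeasurableSet E) (hv : volume E ≠ 0) : wden w r E ≠ 0 := by
  intro h3
  rw [wden, withDensity_apply _ hE, lintegral_eq_zero_iff (hw.ennreal_ofReal.pow_const _)] at h3
  have h4 : ∀ᵐ x ∂(volume.restrict E), False := by
    filter_upwards [h3, ae_restrict_of_ae hpos] with x hx hx0
    simp only [Pi.zero_apply] at hx
    rcases ENNReal.rpow_eq_zero_iff.1 hx with h | h
    · exact hx0 h.1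
    · exact absurd h.1 (by simp)
  rw [Filter.eventually_false_iff_eq_bot, ae_eq_bot, Measure.restrict_eq_zero] at h4
  exact hv h4

theorem hold_w {n : ℕ} {w : Euc n → ℝ} (hw : Measurable w) {a b : ℝ} (ha : 0 < a) (hb : 0 < b)
    (hpos : ∀ᵐ x ∂(volume : Measure (Euc n)), ENNReal.ofReal (w x) ≠ 0) {E : Set (Euc n)}
    (hE : MeasurableSet E) :
    volume E ^ (a + b) ≤ wden w (-(1 / a)) E ^ a * wden w (1 / b) E ^ b := by
  have hab : 0 < a + b := by positivity
  have h1 := ENNReal.lintegral_mul_norm_pow_le (μ := volume.restrict E)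
    (f := fun x => ENNReal.ofReal (w x) ^ (-(1 / a)))
    (g := fun x => ENNReal.ofReal (w x) ^ (1 / b))
    (hw.ennreal_ofReal.pow_const _).aemeasurable (hw.ennreal_ofReal.pow_const _).aemeasurable
    (p := a / (a + b)) (q := b / (a + b)) (by positivity) (by positivity) (by field_simp)
  have h2 : ∫⁻ x in E, (ENNReal.ofReal (w x) ^ (-(1 / a))) ^ (a / (a + b)) *
      (ENNReal.ofReal (w x) ^ (1 / b)) ^ (b / (a + b)) = volume E := by
    calc _ = ∫⁻ x in E, 1 := by
          refine lintegral_congr_ae ?_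
          filter_upwards [ae_restrict_of_ae hpos] with x hx
          rw [← ENNReal.rpow_mul, ← ENNReal.rpow_mul, ← ENNReal.rpow_add _ _ hx (by simp)]
          have : -(1 / a) * (a / (a + b)) + 1 / b * (b / (a + b)) = 0 := by field_simp; ring
          rw [this, ENNReal.rpow_zero]
      _ = _ := by simp
  rw [h2] at h1
  rw [wden, wden, withDensity_apply _ hE, withDensity_apply _ hE]
  calc volume E ^ (a + b) ≤ _ := ENNReal.rpow_le_rpow h1 hab.le
    _ = _ := by
      rw [ENNReal.mul_rpow_of_nonneg _ _ hab.le, ← ENNReal.rpow_mul, ← ENNReal.rpow_mul,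
        div_mul_cancel₀ _ hab.ne', div_mul_cancel₀ _ hab.ne']

theorem apq_w {K v S U : ℝ≥0∞} {a b q p' : ℝ} (ha : 0 < a) (hb : 0 < b) (hqb : q * b = 1)
    (hpa : a * p' = 1) (v0 : v ≠ 0) (vt : v ≠ ⊤) (h : (v⁻¹ * U) * (v⁻¹ * S) ^ (q / p') ≤ K) :
    S ^ a * U ^ b ≤ K ^ b * v ^ (a + b) := by
  have hp' : p' ≠ 0 := right_ne_zero_of_mul_eq_one hpa
  have h1 := ENNReal.rpow_le_rpow h hb.le
  have e : q / p' * b = a := by field_simp; linarith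
  rw [ENNReal.mul_rpow_of_nonneg _ _ hb.le, ← ENNReal.rpow_mul, e,
    ENNReal.mul_rpow_of_nonneg _ _ hb.le, ENNReal.mul_rpow_of_nonneg _ _ ha.le] at h1
  have h2 := mul_le_mul_left h1 (v ^ (a + b))
  refine le_trans (le_of_eq ?_) h2
  rw [ENNReal.rpow_add _ _ v0 vt, ENNReal.inv_rpow, ENNReal.inv_rpow]
  have c1 : (v ^ a)⁻¹ * v ^ a = 1 := ENNReal.inv_mul_cancel (by simp [v0, vt]) (by simp [v0, vt])
  have c2 : (v ^ b)⁻¹ * v ^ b = 1 := ENNReal.inv_mul_cancel (by simp [v0, vt]) (by simp [v0, vt])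
  calc S ^ a * U ^ b = S ^ a * U ^ b * (((v ^ a)⁻¹ * v ^ a) * ((v ^ b)⁻¹ * v ^ b)) := by
        rw [c1, c2, mul_one, mul_one]
    _ = _ := by ring

theorem hyp_w {n : ℕ} (hn : 0 < n) {p q a b : ℝ} (hp : 1 < p) (hq : 0 < q) (ha : 0 < a)
    (hb : 0 < b) (hab : a + b < 1) (hqb : q = 1 / b) (hpa : dualExp p = 1 / a)
    {w : Euc n → ℝ} (hw : Measurable w)
    (hA : Apq p q w < ⊤) (hne : ¬ ∀ᵐ x ∂(volume : Measure (Euc n)), ENNReal.ofReal (w x) = 0)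
    (t : Fin n → Bool) (Qs : Finset (Set (Euc n))) (hQs : ∀ Q ∈ Qs, Q ∈ grid t) :
    Hyp volume (wden w (-(1 / a))) (wden w (1 / b)) a b (Apq p q w ^ b)
      (Geo (2 ^ (-(n * (1 - a - b))))) Qs := by
  have hpos := w_pos hp hq hw hA hne
  have hvol : ∀ Q ∈ grid t, volume Q ≠ 0 ∧ volume Q ≠ ⊤ := by
    rintro _ ⟨⟨k, m⟩, rfl⟩
    simp only [cell_vol]
    refine ⟨pow_ne_zero _ ?_, ENNReal.pow_ne_top (by simp)⟩
    rw [Ne, ENNReal.ofReal_eq_zero, not_le]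
    positivity
  have hmeas : ∀ Q ∈ grid t, MeasurableSet Q := by
    rintro _ ⟨⟨k, m⟩, rfl⟩
    exact cell_meas t k m
  have hcube : ∀ Q ∈ grid t, ∃ (c : Euc n) (h : ℝ), 0 < h ∧ Q ⊆ Cube c h ∧
      volume Q = volume (Cube c h) := by
    rintro _ ⟨⟨k, m⟩, rfl⟩
    exact ⟨_, _, by positivity, cell_sub_Cube t k m, by rw [cell_vol, Cube_vol]⟩
  have hwc : ∀ r (c : Euc n) h, wden w r (Cube c h) = ∫⁻ x in Cube c h, ENNReal.ofReal (w x) ^ r :=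
    fun r c h => withDensity_apply _ (Cube_meas c h)
  refine ⟨ha, hb, hab, grid_lam t Qs hQs, fun Q hQ => hmeas Q (hQs Q hQ),
    fun Q hQ => hvol Q (hQs Q hQ), fun Q hQ => ⟨?_, ?_⟩, fun Q hQ => ⟨?_, ?_⟩, fun Q hQ => ?_,
    fun E hE => hold_w hw ha hb hpos hE, ?_⟩
  · exact wden_ne_zero hw _ hpos (hmeas Q (hQs Q hQ)) (hvol Q (hQs Q hQ)).1
  · obtain ⟨c, h, hh, hsub, -⟩ := hcube Q (hQs Q hQ)
    refine ne_top_of_le_ne_top ?_ (measure_mono hsub)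
    rw [hwc, ← hpa]
    exact sigma_fin hp hq hw hA hne c hh
  · exact wden_ne_zero hw _ hpos (hmeas Q (hQs Q hQ)) (hvol Q (hQs Q hQ)).1
  · obtain ⟨c, h, hh, hsub, -⟩ := hcube Q (hQs Q hQ)
    refine ne_top_of_le_ne_top ?_ (measure_mono hsub)
    rw [hwc, ← hqb]
    exact u_fin hp hq hw hA c hh
  · obtain ⟨c, h, hh, hsub, hv⟩ := hcube Q (hQs Q hQ)
    rw [hv]
    have key := apq_w ha hb (by rw [hqb]; field_simp) (by rw [hpa]; field_simp)
      (Cube_vol_ne c hh).1 (Cube_vol_ne c hh).2 (Apq_cube (q := q) hp w c hh)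
    refine le_trans ?_ key
    rw [hpa, hqb, ← hwc, ← hwc]
    gcongr
  · intro x Ts R hR hT hx
    exact grid_tower hn t (by linarith) x Ts R (fun Q hQ => hQs Q (hT hQ)) hx

theorem minkowski_fin {X ι : Type*} [MeasurableSpace X] {u : Measure X} {q : ℝ} (hq : 1 ≤ q)
    (h : ι → X → ℝ≥0∞) (hm : ∀ i, Measurable (h i)) (S : Finset ι) :
    (∫⁻ x, (∑ i ∈ S, h i x) ^ q ∂u) ^ (1 / q) ≤ ∑ i ∈ S, (∫⁻ x, h i x ^ q ∂u) ^ (1 / q) := by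
  classical
  have hq0 : 0 < q := by linarith
  induction S using Finset.induction_on with
  | empty => simp [ENNReal.zero_rpow_of_pos hq0, hq0]
  | insert i S hi ih =>
    simp only [Finset.sum_insert hi]
    refine (ENNReal.lintegral_Lp_add_le (hm i).aemeasurable
      (Finset.measurable_fun_sum S fun j _ => hm j).aemeasurable hq).trans ?_
    exact add_le_add le_rfl ih

/-- full dyadic operator -/
def Hop {n : ℕ} (s : ℝ) (t : Fin n → Bool) (F : Euc n → ℝ≥0∞) (x : Euc n) : ℝ≥0∞ :=
  ∑' Q : grid t, (Q : Set (Euc n)).indicator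
    (fun _ => volume (Q : Set (Euc n)) ^ (s - 1) * ∫⁻ y in (Q : Set (Euc n)), F y) x

theorem grid_meas {n : ℕ} {t : Fin n → Bool} (Q : grid t) : MeasurableSet (Q : Set (Euc n)) := by
  obtain ⟨_, ⟨⟨k, m⟩, rfl⟩⟩ := Q
  exact cell_meas t k m

theorem Hop_meas {n : ℕ} (s : ℝ) (t : Fin n → Bool) (F : Euc n → ℝ≥0∞) :
    Measurable (Hop s t F) := by
  have : Countable (grid t) := (grid_countable t).to_subtype
  exact Measurable.ennreal_tsum fun Q => measurable_const.indicator (grid_meas Q)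

theorem riesz_le {n : ℕ} (hn : 0 < n) {α : ℝ} (hαn : α < n) {f : Euc n → ℝ} (hf : Measurable f)
    (x : Euc n) :
    riesz α f x ≤ ENNReal.ofReal (6 ^ ((n:ℝ) - α)) *
      ∑ t : Fin n → Bool, Hop (α / n) t (fun y => ENNReal.ofReal |f y|) x := by
  set F : Euc n → ℝ≥0∞ := fun y => ENNReal.ofReal |f y| with hF
  have hFm : Measurable F := (measurable_abs.comp hf).ennreal_ofReal
  set c := ENNReal.ofReal (6 ^ ((n:ℝ) - α)) with hc
  have hcount : ∀ t : Fin n → Bool, Countable (grid t) := fun t => (grid_countable t).to_subtype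
  have hm1 : ∀ (t : Fin n → Bool) (Q : grid t), Measurable (fun y : Euc n =>
      F y * (volume (Q : Set (Euc n)) ^ (α / n - 1) *
        ((Q : Set (Euc n)).indicator 1 x * (Q : Set (Euc n)).indicator 1 y))) := by
    intro t Q
    refine hFm.mul (Measurable.const_mul (Measurable.const_mul ?_ _) _)
    exact measurable_one.indicator (grid_meas Q)
  calc riesz α f x ≤ ∫⁻ y, F y * (c *
      ∑ t : Fin n → Bool, ∑' Q : grid t, volume (Q : Set (Euc n)) ^ (α / n - 1) *
        ((Q : Set (Euc n)).indicator 1 x * (Q : Set (Euc n)).indicator 1 y)) := by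
        refine lintegral_mono fun y => ?_
        exact mul_le_mul_right (kernel_bound hn hαn x y) _
    _ = ∫⁻ y, c * ∑ t : Fin n → Bool, ∑' Q : grid t,
        F y * (volume (Q : Set (Euc n)) ^ (α / n - 1) *
        ((Q : Set (Euc n)).indicator 1 x * (Q : Set (Euc n)).indicator 1 y)) := by
        refine lintegral_congr fun y => ?_
        rw [mul_left_comm, Finset.mul_sum]
        simp only [ENNReal.tsum_mul_left]
    _ = c * ∑ t : Fin n → Bool, ∑' Q : grid t, ∫⁻ y,
        F y * (volume (Q : Set (Euc n)) ^ (α / n - 1) *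
        ((Q : Set (Euc n)).indicator 1 x * (Q : Set (Euc n)).indicator 1 y)) := by
        rw [lintegral_const_mul _ (Finset.measurable_fun_sum _ fun t _ =>
          Measurable.ennreal_tsum (hm1 t)), lintegral_finsetSum _ (fun t _ =>
          Measurable.ennreal_tsum (hm1 t))]
        congr 1
        refine Finset.sum_congr rfl fun t _ => ?_
        rw [lintegral_tsum fun Q => (hm1 t Q).aemeasurable]
    _ = _ := by
        congr 1
        refine Finset.sum_congr rfl fun t _ => ?_
        unfold Hop
        refine tsum_congr fun Q => ?_
        by_cases hx : x ∈ (Q : Set (Euc n))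
        · simp only [hx, indicator_of_mem, Pi.one_apply, one_mul]
          rw [← lintegral_indicator (grid_meas Q), ← lintegral_const_mul _
            (hFm.indicator (grid_meas Q))]
          refine lintegral_congr fun y => ?_
          by_cases hy : y ∈ (Q : Set (Euc n)) <;> simp [hy, mul_comm]
        · simp [hx]

theorem Hop_bound {n : ℕ} {a b s : ℝ} {L D C : ℝ≥0∞} {σ u : Measure (Euc n)} {t : Fin n → Bool}
    (hs : 1 - a - b = s) (hb : 0 < b)
    (H : ∀ Qs : Finset (Set (Euc n)), (∀ Q ∈ Qs, Q ∈ grid t) → Hyp volume σ u a b L D Qs)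
    {f F : Euc n → ℝ≥0∞} (hf : Measurable f)
    (hfF : ∀ Q ∈ grid t, ∫⁻ y in Q, f y ∂σ = ∫⁻ y in Q, F y)
    (hC : Cside a b D L + Cside b a D L ≤ C) (hC0 : C ≠ 0) :
    (∫⁻ x, Hop s t F x ^ (1 / b) ∂u) ^ b ≤ C * (∫⁻ x, f x ^ (1 / (1 - a)) ∂σ) ^ (1 - a) := by
  have : Countable (grid t) := (grid_countable t).to_subtype
  have hb0 : 0 < 1 / b := by positivity
  set M : Finset (grid t) → Finset (Set (Euc n)) := fun T => T.map (Function.Embedding.subtype _)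
    with hM
  have hMg : ∀ T, ∀ Q ∈ M T, Q ∈ grid t := by
    intro T Q hQ
    simp only [hM, Finset.mem_map] at hQ
    obtain ⟨Q, -, rfl⟩ := hQ
    exact Q.2
  have e1 : ∀ x, Hop s t F x = ⨆ T : Finset (grid t), hop volume σ (s - 1) (M T) f x := by
    intro x
    unfold Hop
    rw [ENNReal.tsum_eq_iSup_sum]
    refine iSup_congr fun T => ?_
    simp only [hop, hM, Finset.sum_map, Function.Embedding.subtype_apply]
    refine Finset.sum_congr rfl fun Q _ => ?_
    rw [hfF Q Q.2]
  have e2 : ∀ x, Hop s t F x ^ (1 / b) =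
      ⨆ T : Finset (grid t), hop volume σ (s - 1) (M T) f x ^ (1 / b) := by
    intro x
    rw [e1 x]
    exact (ENNReal.orderIsoRpow (1 / b) hb0).map_iSup _
  simp only [e2]
  rw [lintegral_iSup_directed]
  · have e3 : ∀ g : Finset (grid t) → ℝ≥0∞, (⨆ T, g T) ^ b = ⨆ T, g T ^ b := fun g =>
      (ENNReal.orderIsoRpow b hb).map_iSup _
    rw [e3]
    refine iSup_le fun T => ?_
    have := dual (H (M T) (hMg T)) hf hC hC0
    rwa [hs] at this
  · intro T
    exact ((hop_meas (H (M T) (hMg T)).meas f).pow_const _).aemeasurable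
  · classical
    refine Monotone.directed_le fun T T' hTT' x => ?_
    refine ENNReal.rpow_le_rpow ?_ hb0.le
    exact Finset.sum_le_sum_of_subset (Finset.map_subset_map.2 hTT')

theorem const_bound {a b : ℝ} (ha : 0 < a) (hb : 0 < b) {D K : ℝ≥0∞} (hK : 1 ≤ K) :
    Cside a b D (K ^ b) + Cside b a D (K ^ b) ≤
      (Cside a b D 1 + Cside b a D 1 + 1) * K ^ ((a + b) * max 1 (b / a)) := by
  rw [Cside_scale ha hb, Cside_scale hb ha, ← ENNReal.rpow_mul, ← ENNReal.rpow_mul]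
  have h1 : K ^ (b * (1 + b / a)) ≤ K ^ ((a + b) * max 1 (b / a)) := by
    refine ENNReal.rpow_le_rpow_of_exponent_le hK ?_
    have : b * (1 + b / a) = (a + b) * (b / a) := by field_simp
    rw [this]
    gcongr
    exact le_max_right _ _
  have h2 : K ^ (b * (1 + a / b)) ≤ K ^ ((a + b) * max 1 (b / a)) := by
    refine ENNReal.rpow_le_rpow_of_exponent_le hK ?_
    have : b * (1 + a / b) = (a + b) * 1 := by field_simp; ring
    rw [this]
    gcongr
    exact le_max_left _ _
  calc _ ≤ Cside a b D 1 * K ^ ((a + b) * max 1 (b / a)) +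
        Cside b a D 1 * K ^ ((a + b) * max 1 (b / a)) := by gcongr
    _ = (Cside a b D 1 + Cside b a D 1) * K ^ ((a + b) * max 1 (b / a)) := by ring
    _ ≤ _ := mul_le_mul_left le_self_add _

/-- Sharp strong-type bound for the Riesz potential in the full range of
exponents (Theorem 2.6). -/
theorem riesz_strong_type_sharp_bound
    (n : ℕ) (hn : 0 < n) (α p q : ℝ) (hα : 0 < α) (hαn : α < n)
    (hp : 1 < p) (hpn : p < n / α) (hq : 1 / q = 1 / p - α / n) :
    ∃ c : ℝ, 0 < c ∧ ∀ w f : Euc n → ℝ, Measurable w → (∀ x, 0 ≤ w x) → Measurable f →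
      Apq p q w < ⊤ →
      wLpE w (riesz α f) q ≤
        ENNReal.ofReal c * Apq p q w ^ ((1 - α / n) * max 1 (dualExp p / q)) * wLp w f p := by
  have hn' : (0:ℝ) < n := by exact_mod_cast hn
  have hp0 : 0 < p := by linarith
  obtain ⟨b, hbdef⟩ : ∃ b, b = 1 / q := ⟨_, rfl⟩
  obtain ⟨a, hadef⟩ : ∃ a, a = 1 - 1 / p := ⟨_, rfl⟩
  have hb : 0 < b := by
    rw [hbdef, hq, sub_pos, div_lt_div_iff₀ hn' hp0]
    rw [lt_div_iff₀ hα] at hpn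
    linarith
  have ha : 0 < a := by
    rw [hadef, sub_pos, div_lt_one hp0]; exact hp
  have hs : 1 - a - b = α / n := by rw [hadef, hbdef, hq]; ring
  have hsn : 0 < α / n := by positivity
  have hab : a + b < 1 := by linarith
  have hqb : q = 1 / b := by rw [hbdef]; simp
  have hq0 : 0 < q := by rw [hqb]; positivity
  have hq1 : 1 ≤ q := by rw [hqb, le_div_iff₀ hb]; linarith
  have hpa : dualExp p = 1 / a := by
    have : p - 1 ≠ 0 := by linarith
    rw [dualExp, hadef]; field_simp
  have hp1a : p = 1 / (1 - a) := by rw [hadef]; simp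
  have ha1 : 1 - a = 1 / p := by rw [hadef]; ring
  obtain ⟨D, hDdef⟩ : ∃ D : ℝ≥0∞, D = Geo (2 ^ (-(n * (1 - a - b)))) := ⟨_, rfl⟩
  have hDt : D ≠ ⊤ := by
    rw [hDdef, hs]
    exact Geo_ne_top (two_rpow_neg_lt (by positivity))
  obtain ⟨C0, hC0⟩ : ∃ C0 : ℝ≥0∞, C0 = Cside a b D 1 + Cside b a D 1 + 1 := ⟨_, rfl⟩
  have hC0t : C0 ≠ ⊤ := by
    rw [hC0]
    exact ENNReal.add_ne_top.2 ⟨ENNReal.add_ne_top.2 ⟨Cside_ne_top ha hb hab hDt,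
      Cside_ne_top hb ha (by linarith) hDt⟩, one_ne_top⟩
  have hC00 : C0 ≠ 0 := by rw [hC0]; simp
  obtain ⟨Ct, hCt⟩ : ∃ Ct : ℝ≥0∞, Ct = ENNReal.ofReal (6 ^ ((n:ℝ) - α)) *
    ((Fintype.card (Fin n → Bool) : ℕ) * C0) := ⟨_, rfl⟩
  have hCtt : Ct ≠ ⊤ := by
    rw [hCt]
    exact ENNReal.mul_ne_top (by simp) (ENNReal.mul_ne_top (by simp) hC0t)
  have hCt0 : Ct ≠ 0 := by
    rw [hCt]
    refine mul_ne_zero ?_ (mul_ne_zero ?_ hC00)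
    · rw [Ne, ENNReal.ofReal_eq_zero, not_le]; positivity
    · simp
  refine ⟨Ct.toReal, ENNReal.toReal_pos hCt0 hCtt, ?_⟩
  intro w f hw hw0 hf hA
  rw [ENNReal.ofReal_toReal hCtt]
  by_cases hne : ∀ᵐ x ∂(volume : Measure (Euc n)), ENNReal.ofReal (w x) = 0
  · have : wLpE w (riesz α f) q = 0 := by
      unfold wLpE
      have : ∫⁻ x, (ENNReal.ofReal (w x) * riesz α f x) ^ q = 0 := by
        rw [← lintegral_zero (μ := (volume : Measure (Euc n)))]
        refine lintegral_congr_ae ?_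
        filter_upwards [hne] with x hx
        rw [hx, zero_mul, ENNReal.zero_rpow_of_pos hq0]
      rw [this, ENNReal.zero_rpow_of_pos (by positivity)]
    rw [this]; exact zero_le
  set K := Apq p q w with hKdef
  have hpos := w_pos hp hq0 hw hA hne
  obtain ⟨σ, hσ⟩ : ∃ σ, σ = wden w (-(1 / a)) := ⟨_, rfl⟩
  obtain ⟨u, hu⟩ : ∃ u, u = wden w (1 / b) := ⟨_, rfl⟩
  have H : ∀ (t : Fin n → Bool) (Qs : Finset (Set (Euc n))), (∀ Q ∈ Qs, Q ∈ grid t) →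
      Hyp volume σ u a b (K ^ b) D Qs := by
    intro t Qs hQs
    rw [hσ, hu, hDdef]
    exact hyp_w hn hp hq0 ha hb hab hqb hpa hw hA hne t Qs hQs
  have hK1 : 1 ≤ K := by
    have t0 : Fin n → Bool := fun _ => false
    have h1 := H t0 {cell t0 0 0} (by
      intro Q hQ
      rw [Finset.mem_singleton] at hQ
      exact ⟨(0, 0), hQ.symm⟩)
    have hmem := Finset.mem_singleton_self (cell t0 0 0)
    have h2 := (h1.hold _ (h1.meas _ hmem)).trans (h1.apq _ hmem)
    rw [cell_vol] at h2
    simp only [neg_zero, zpow_zero, ENNReal.ofReal_one, one_pow, ENNReal.one_rpow, mul_one] at h2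
    by_contra hlt
    push Not at hlt
    exact absurd h2 (not_le.2 (ENNReal.rpow_lt_one hlt hb))
  set F : Euc n → ℝ≥0∞ := fun y => ENNReal.ofReal |f y| with hF
  have hFm : Measurable F := (measurable_abs.comp hf).ennreal_ofReal
  set W : Euc n → ℝ≥0∞ := fun y => ENNReal.ofReal (w y) with hW
  have hWm : Measurable W := hw.ennreal_ofReal
  set g : Euc n → ℝ≥0∞ := fun y => F y * W y ^ (1 / a) with hg
  have hgm : Measurable g := hFm.mul (hWm.pow_const _)
  have hgF : ∀ Q, MeasurableSet Q → ∫⁻ y in Q, g y ∂σ = ∫⁻ y in Q, F y := by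
    intro Q hQ
    rw [hσ, wden, restrict_withDensity hQ,
      lintegral_withDensity_eq_lintegral_mul _ (hWm.pow_const _) hgm]
    refine lintegral_congr_ae ?_
    filter_upwards [ae_restrict_of_ae hpos] with x hx
    simp only [Pi.mul_apply, hg]
    rw [mul_left_comm, ← ENNReal.rpow_add _ _ hx (by simp), neg_add_cancel, ENNReal.rpow_zero,
      mul_one]
  have hgN : (∫⁻ x, g x ^ (1 / (1 - a)) ∂σ) ^ (1 - a) = wLp w f p := by
    rw [← hp1a, ha1, wLp, hσ, wden,
      lintegral_withDensity_eq_lintegral_mul _ (hWm.pow_const _) (hgm.pow_const _)]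
    congr 1
    refine lintegral_congr_ae ?_
    filter_upwards [hpos] with x hx
    simp only [Pi.mul_apply, hg]
    rw [ENNReal.mul_rpow_of_nonneg _ _ hp0.le, ENNReal.mul_rpow_of_nonneg _ _ hp0.le,
      ← ENNReal.rpow_mul, mul_left_comm, ← ENNReal.rpow_add _ _ hx (by simp), mul_comm]
    congr 2
    rw [← hpa, dualExp]
    have : p - 1 ≠ 0 := by linarith
    field_simp
    ring
  have hE : (1 - α / n) * max 1 (dualExp p / q) = (a + b) * max 1 (b / a) := by
    rw [← hs, hpa, hqb]
    congr 1
    · ring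
    · congr 1; field_simp
  set KE := K ^ ((1 - α / n) * max 1 (dualExp p / q)) with hKE
  have hKE0 : KE ≠ 0 := by
    rw [hKE]
    exact (ENNReal.rpow_pos (lt_of_lt_of_le one_pos hK1) hA.ne).ne'
  have hHop : ∀ t : Fin n → Bool, (∫⁻ x, Hop (α / n) t F x ^ q ∂u) ^ (1 / q) ≤
      C0 * KE * wLp w f p := by
    intro t
    rw [← hgN, ← hbdef, hqb]
    refine Hop_bound hs hb (H t) hgm (fun Q hQ => hgF Q (grid_meas ⟨Q, hQ⟩)) ?_
      (mul_ne_zero hC00 hKE0)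
    rw [hC0, hKE, hE]
    exact const_bound ha hb hK1
  have hLHS : wLpE w (riesz α f) q ≤ ENNReal.ofReal (6 ^ ((n:ℝ) - α)) *
      (∫⁻ x, (∑ t : Fin n → Bool, Hop (α / n) t F x) ^ q ∂u) ^ (1 / q) := by
    have hSm : Measurable fun x => ∑ t : Fin n → Bool, Hop (α / n) t F x :=
      Finset.measurable_fun_sum _ fun t _ => Hop_meas _ t F
    set c6 := ENNReal.ofReal (6 ^ ((n:ℝ) - α)) with hc6
    calc wLpE w (riesz α f) q
        ≤ (∫⁻ x, c6 ^ q * (W x ^ q * (∑ t : Fin n → Bool, Hop (α / n) t F x) ^ q)) ^ (1 / q) := by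
          unfold wLpE
          refine ENNReal.rpow_le_rpow (lintegral_mono fun x => ?_) (by positivity)
          calc _ ≤ (W x * (c6 * ∑ t : Fin n → Bool, Hop (α / n) t F x)) ^ q :=
                ENNReal.rpow_le_rpow (mul_le_mul_right (riesz_le hn hαn hf x) _) hq0.le
            _ = _ := by
                rw [ENNReal.mul_rpow_of_nonneg _ _ hq0.le, ENNReal.mul_rpow_of_nonneg _ _ hq0.le]
                ring
      _ = _ := by
          have hmm : Measurable fun x => W x ^ q * (∑ t : Fin n → Bool, Hop (α / n) t F x) ^ q :=
            (hWm.pow_const _).mul (hSm.pow_const _)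
          rw [lintegral_const_mul _ hmm,
            ENNReal.mul_rpow_of_nonneg _ _ (by positivity), ← ENNReal.rpow_mul,
            mul_one_div_cancel hq0.ne', ENNReal.rpow_one, hu, wden,
            lintegral_withDensity_eq_lintegral_mul _ (hWm.pow_const _) (hSm.pow_const _), ← hqb]
          rfl
  calc wLpE w (riesz α f) q ≤ _ := hLHS
    _ ≤ ENNReal.ofReal (6 ^ ((n:ℝ) - α)) * ∑ t : Fin n → Bool, C0 * KE * wLp w f p := by
        gcongr
        exact (minkowski_fin hq1 _ (fun t => Hop_meas _ t F) _).trans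
          (Finset.sum_le_sum fun t _ => hHop t)
    _ = _ := by
        rw [Finset.sum_const, Finset.card_univ, nsmul_eq_mul, hCt]
        ring

end
end

section
/- Sharpness of the strong-type exponent for the Riesz potential: Let 0 < α < n, 1 < p < n/α, and define q by 1/q = 1/p − α/n. Then for every exponent γ with 0 ≤ γ < (1−α/n)·max{1, p′/q} there is NO constant c such that ‖w·I_α f‖_{L^{q}(ℝⁿ)} ≤ c [w]_{A_{p,q}}^{γ} ‖w·f‖_{L^{p}(ℝⁿ)} holds for all weights w ∈ A_{p,q} and all measurable f. -/
open MeasureTheory ENNReal Set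

noncomputable section

variable {n : ℕ}

/-- Surface area of the unit sphere. -/
def sphS (n : ℕ) : ℝ := n * (volume : Measure (Euc n)).real (Metric.ball 0 1)

lemma sphS_pos (hn : 0 < n) : 0 < sphS n := by
  unfold sphS
  have : 0 < (volume : Measure (Euc n)).real (Metric.ball 0 1) :=
    ENNReal.toReal_pos (Metric.measure_ball_pos volume _ one_pos).ne' measure_ball_lt_top.ne
  positivity

lemma radial (hn : 0 < n) (s : ℝ) (T : Set ℝ) (hT : MeasurableSet T)
    (hi : IntegrableOn (fun y : ℝ => y ^ (s + n - 1)) (Ioi 0 ∩ T)) :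
    ∫⁻ x in {x : Euc n | ‖x‖ ∈ T}, ENNReal.ofReal (‖x‖ ^ s) =
      ENNReal.ofReal (sphS n * ∫ y in Ioi 0 ∩ T, y ^ (s + n - 1)) := by
  have : Nonempty (Fin n) := ⟨⟨0, hn⟩⟩
  have hTm : MeasurableSet {x : Euc n | ‖x‖ ∈ T} := measurable_norm hT
  set F : ℝ → ℝ := T.indicator (fun y => y ^ s) with hF
  have hFnn : ∀ x : Euc n, 0 ≤ F ‖x‖ := fun x =>
    indicator_apply_nonneg fun _ => Real.rpow_nonneg (norm_nonneg _) _
  have e1 : ∫⁻ x in {x : Euc n | ‖x‖ ∈ T}, ENNReal.ofReal (‖x‖ ^ s) =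
      ∫⁻ x : Euc n, ENNReal.ofReal (F ‖x‖) := by
    rw [← lintegral_indicator hTm]
    congr 1; ext x
    by_cases h : ‖x‖ ∈ T <;> simp [hF, indicator, h]
  have hcong : ∀ y ∈ Ioi (0:ℝ), y ^ (Module.finrank ℝ (Euc n) - 1) • F y =
      T.indicator (fun y : ℝ => y ^ (s + n - 1)) y := by
    intro y hy
    by_cases h : y ∈ T
    · simp only [hF, indicator_of_mem h, smul_eq_mul, finrank_euclideanSpace, Fintype.card_fin]
      rw [← Real.rpow_natCast, ← Real.rpow_add hy]
      congr 1
      rw [Nat.cast_sub hn]; push_cast; ring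
    · simp [hF, h]
  have hint : Integrable (fun x : Euc n => F ‖x‖) := by
    rw [integrable_fun_norm_addHaar volume (f := F), integrableOn_congr_fun hcong measurableSet_Ioi,
      integrableOn_indicator_iff hT, inter_comm]
    exact hi
  rw [e1, ← ofReal_integral_eq_lintegral_ofReal hint (Filter.Eventually.of_forall hFnn),
    integral_fun_norm_addHaar volume F, setIntegral_congr_fun measurableSet_Ioi hcong,
    setIntegral_indicator hT]
  simp [sphS, mul_assoc]

lemma radial_ball (hn : 0 < n) {δ R : ℝ} (hδ : 0 < δ) (hR : 0 < R) :
    ∫⁻ x in Metric.ball (0 : Euc n) R, ENNReal.ofReal (‖x‖ ^ (δ - n)) =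
      ENNReal.ofReal (sphS n * (R ^ δ / δ)) := by
  have h := radial hn (δ - n) (Iio R) measurableSet_Iio
  have e : (δ - n + n - 1 : ℝ) = δ - 1 := by ring
  rw [e, Ioi_inter_Iio] at h
  have h2 := h ((intervalIntegral.integrableOn_Ioo_rpow_iff hR).2 (by linarith))
  rw [← integral_Ioc_eq_integral_Ioo, ← intervalIntegral.integral_of_le hR.le,
    integral_rpow (Or.inl (by linarith))] at h2
  have e2 : {x : Euc n | ‖x‖ ∈ Iio R} = Metric.ball 0 R := by ext; simp
  rw [e2] at h2
  rw [h2]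
  simp [Real.zero_rpow hδ.ne']

lemma radial_compl (hn : 0 < n) {ε : ℝ} (hε : 0 < ε) :
    ∫⁻ x in (Metric.ball (0 : Euc n) 1)ᶜ, ENNReal.ofReal (‖x‖ ^ (-n - ε)) =
      ENNReal.ofReal (sphS n / ε) := by
  have h := radial hn (-n - ε) (Ici 1) measurableSet_Ici
  have e : (-n - ε + n - 1 : ℝ) = - ε - 1 := by ring
  have e3 : Ioi (0:ℝ) ∩ Ici 1 = Ici 1 := by
    apply inter_eq_right.2; intro x hx; exact lt_of_lt_of_le one_pos (mem_Ici.1 hx)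
  rw [e, e3, integrableOn_Ici_iff_integrableOn_Ioi] at h
  have h2 := h (integrableOn_Ioi_rpow_of_lt (by linarith) one_pos)
  rw [integral_Ici_eq_integral_Ioi, integral_Ioi_rpow_of_lt (by linarith) one_pos] at h2
  have e2 : {x : Euc n | ‖x‖ ∈ Ici 1} = (Metric.ball 0 1)ᶜ := by ext; simp
  rw [e2] at h2
  rw [h2]
  congr 1
  simp
  field_simp

lemma volume_Cube (a : Euc n) {h : ℝ} (hh : 0 < h) :
    volume (Cube a h) = ENNReal.ofReal (h ^ n) := by
  have e : Cube a h = (@WithLp.ofLp 2 (Fin n → ℝ)) ⁻¹' (Icc (fun i => a i) (fun i => a i + h)) := by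
    ext x
    simp [Cube, Pi.le_def, forall_and]
  rw [e, (PiLp.volume_preserving_ofLp (Fin n)).measure_preimage measurableSet_Icc.nullMeasurableSet,
    Real.volume_Icc_pi]
  simp [ENNReal.ofReal_pow hh.le]

lemma measurableSet_Cube (a : Euc n) (h : ℝ) : MeasurableSet (Cube a h) := by
  have e : Cube a h = (@WithLp.ofLp 2 (Fin n → ℝ)) ⁻¹' (Icc (fun i => a i) (fun i => a i + h)) := by
    ext x
    simp [Cube, Pi.le_def, forall_and]
  rw [e]
  exact (PiLp.volume_preserving_ofLp (Fin n)).measurable measurableSet_Icc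

lemma Cube_dist {a x : Euc n} {h : ℝ} (hh : 0 < h) (hx : x ∈ Cube a h) :
    ‖x - a‖ ≤ h * √n := by
  rw [EuclideanSpace.norm_eq]
  have : ∑ i, ‖(x - a) i‖ ^ 2 ≤ h ^ 2 * n := by
    calc ∑ i, ‖(x - a) i‖ ^ 2 ≤ ∑ i : Fin n, h ^ 2 := by
          apply Finset.sum_le_sum
          intro i _
          have := hx i
          apply pow_le_pow_left₀ (norm_nonneg _)
          simp only [PiLp.sub_apply, Real.norm_eq_abs]
          rw [abs_le]; constructor <;> linarith
      _ = h ^ 2 * n := by simp [mul_comm]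
  calc √(∑ i, ‖(x - a) i‖ ^ 2) ≤ √(h ^ 2 * n) := Real.sqrt_le_sqrt this
    _ = h * √n := by rw [Real.sqrt_mul (by positivity), Real.sqrt_sq hh.le]

lemma ae_ne_zero (hn : 0 < n) : ∀ᵐ x : Euc n, x ≠ 0 := by
  have : Nonempty (Fin n) := ⟨⟨0, hn⟩⟩
  exact ae_iff.2 (by simp)

lemma avg_le (a : Euc n) {h : ℝ} (hh : 0 < h) (g : Euc n → ℝ≥0∞) (M : ℝ≥0∞)
    (hg : ∀ᵐ x, x ∈ Cube a h → g x ≤ M) :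
    (volume (Cube a h))⁻¹ * ∫⁻ x in Cube a h, g x ≤ M := by
  have hv := volume_Cube a hh
  calc (volume (Cube a h))⁻¹ * ∫⁻ x in Cube a h, g x
      ≤ (volume (Cube a h))⁻¹ * ∫⁻ x in Cube a h, M := by
        gcongr 1
        exact setLIntegral_mono_ae' (measurableSet_Cube a h) hg
    _ = M := by
        rw [setLIntegral_const, mul_comm M, ← mul_assoc, ENNReal.inv_mul_cancel, one_mul]
        · rw [hv]; simp; positivity
        · rw [hv]; simp

lemma A1 (hn : 0 < n) : ∃ C : ℝ, 0 < C ∧ ∀ δ : ℝ, 0 < δ → δ ≤ 1 / 2 → ∀ (a : Euc n) (h : ℝ), 0 < h →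
    ∃ m : ℝ, 0 < m ∧ (∀ x ∈ Cube a h, x ≠ 0 → m ≤ ‖x‖ ^ (δ - n)) ∧
      (volume (Cube a h))⁻¹ * ∫⁻ x in Cube a h, ENNReal.ofReal (‖x‖ ^ (δ - n)) ≤
        ENNReal.ofReal (C / δ * m) := by
  have hS := sphS_pos hn
  have hn1 : (1:ℝ) ≤ n := by exact_mod_cast hn
  have hsq : 0 < √(n:ℝ) := Real.sqrt_pos.2 (by positivity)
  refine ⟨3 ^ n + sphS n * (5 * √n) ^ n, by positivity, fun δ hδ hδ2 a h hh => ?_⟩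
  set r := h * √n with hr
  have hrp : 0 < r := by positivity
  set R := ‖a‖ + r + r with hR
  have hRp : 0 < R := by positivity
  have hxR : ∀ x ∈ Cube a h, ‖x‖ < R := fun x hx => by
    have h1 := Cube_dist hh hx
    have h2 := norm_le_norm_add_norm_sub a x
    rw [norm_sub_rev] at h2
    linarith
  refine ⟨R ^ (δ - n), by positivity, fun x hx hx0 => ?_, ?_⟩
  · exact Real.rpow_le_rpow_of_nonpos (norm_pos_iff.2 hx0) (hxR x hx).le (by linarith)
  · rcases le_total (3 * r) ‖a‖ with hc | hc
    · apply avg_le a hh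
      filter_upwards [] with x hx
      apply ENNReal.ofReal_le_ofReal
      have h1 := Cube_dist hh hx
      have h2 := norm_le_norm_add_norm_sub x a
      have h3 : R / 3 ≤ ‖x‖ := by linarith
      calc ‖x‖ ^ (δ - n) ≤ (R / 3) ^ (δ - n) :=
            Real.rpow_le_rpow_of_nonpos (by positivity) h3 (by linarith)
        _ = 3 ^ (n - δ) * R ^ (δ - n) := by
            rw [Real.div_rpow hRp.le (by norm_num), ← neg_sub (n:ℝ) δ, Real.rpow_neg (x := 3) (by norm_num)]
            field_simp
        _ ≤ 3 ^ n * R ^ (δ - n) := by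
            gcongr
            rw [← Real.rpow_natCast]
            exact Real.rpow_le_rpow_of_exponent_le (by norm_num) (by linarith)
        _ ≤ _ := by
            gcongr
            rw [le_div_iff₀ hδ]
            have : 0 < sphS n * (5 * √n) ^ n := by positivity
            have : (3:ℝ) ^ n * δ ≤ 3 ^ n * 1 := by gcongr; linarith
            linarith
    · have hsub : Cube a h ⊆ Metric.ball 0 R := fun x hx => by simpa using hxR x hx
      have hR5 : R ≤ 5 * √n * h := by rw [hR]; linarith
      rw [volume_Cube a hh]
      calc _ ≤ (ENNReal.ofReal (h ^ n))⁻¹ * ∫⁻ x in Metric.ball (0 : Euc n) R,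
              ENNReal.ofReal (‖x‖ ^ (δ - n)) := by
            gcongr 1
            exact lintegral_mono_set hsub
        _ = ENNReal.ofReal ((h ^ n)⁻¹ * (sphS n * (R ^ δ / δ))) := by
            rw [radial_ball hn hδ hRp, ← ENNReal.ofReal_inv_of_pos (by positivity),
              ← ENNReal.ofReal_mul (by positivity)]
        _ ≤ _ := by
            apply ENNReal.ofReal_le_ofReal
            have h5 : R ^ n ≤ (5 * √n) ^ n * h ^ n := by
              rw [← mul_pow]; gcongr
            have h6 : (h ^ n)⁻¹ ≤ (5 * √n) ^ n / R ^ n := by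
              rw [le_div_iff₀ (by positivity), inv_mul_le_iff₀ (by positivity)]; linarith
            rw [Real.rpow_sub hRp, Real.rpow_natCast]
            calc _ ≤ (5 * √n) ^ n / R ^ n * (sphS n * (R ^ δ / δ)) := by gcongr
              _ = sphS n * (5 * √n) ^ n / δ * (R ^ δ / R ^ n) := by ring
              _ ≤ _ := by
                gcongr
                have : (0:ℝ) < 3 ^ n := by positivity
                linarith

lemma ofReal_pw {x : Euc n} (hx : x ≠ 0) (a b : ℝ) :
    ENNReal.ofReal (‖x‖ ^ a) ^ b = ENNReal.ofReal (‖x‖ ^ (a * b)) := by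
  have : 0 < ‖x‖ := norm_pos_iff.2 hx
  rw [ENNReal.ofReal_rpow_of_pos (by positivity), ← Real.rpow_mul this.le]

lemma avg_pw (hn : 0 < n) (a : Euc n) (h : ℝ) (θ b : ℝ) :
    ∫⁻ x in Cube a h, ENNReal.ofReal (‖x‖ ^ θ) ^ b =
      ∫⁻ x in Cube a h, ENNReal.ofReal (‖x‖ ^ (θ * b)) := by
  apply lintegral_congr_ae
  filter_upwards [ae_restrict_of_ae (ae_ne_zero hn)] with x hx
  exact ofReal_pw hx _ _

lemma avg_neg (hn : 0 < n) (a : Euc n) {h : ℝ} (hh : 0 < h) {s κ m : ℝ} (hκ : 0 < κ) (hm : 0 < m)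
    (hu : ∀ x ∈ Cube a h, x ≠ 0 → m ≤ ‖x‖ ^ s) :
    (volume (Cube a h))⁻¹ * ∫⁻ x in Cube a h, ENNReal.ofReal (‖x‖ ^ (s * (-κ))) ≤
      ENNReal.ofReal (m ^ (-κ)) := by
  apply avg_le a hh
  filter_upwards [ae_ne_zero hn] with x hx0 hx
  apply ENNReal.ofReal_le_ofReal
  rw [Real.rpow_mul (norm_nonneg _)]
  exact Real.rpow_le_rpow_of_nonpos hm (hu x hx hx0) (by linarith)

/-- first family of weights -/
lemma Apq_A (hn : 0 < n) {p q : ℝ} (hp : 1 < p) (hq : 0 < q) : ∃ C : ℝ, 0 < C ∧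
    ∀ δ : ℝ, 0 < δ → δ ≤ 1 / 2 →
    Apq p q (fun x : Euc n => ‖x‖ ^ ((n - δ) / dualExp p)) ≤
      ENNReal.ofReal ((C / δ) ^ (q / dualExp p)) := by
  obtain ⟨C, hC, H⟩ := A1 hn
  have hp' : 0 < dualExp p := div_pos (by linarith) (by linarith)
  refine ⟨C, hC, fun δ hδ hδ2 => ?_⟩
  refine iSup_le fun a => iSup_le fun h => iSup_le fun hh => ?_
  rw [if_neg hp.ne']
  obtain ⟨m, hm, hu, hav⟩ := H δ hδ hδ2 a h hh
  rw [avg_pw hn, avg_pw hn]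
  have e1 : (n - δ) / dualExp p * q = (δ - n) * (-(q / dualExp p)) := by ring
  have e2 : (n - δ) / dualExp p * (-dualExp p) = δ - n := by field_simp; ring
  rw [e1, e2]
  have hκ : 0 < q / dualExp p := by positivity
  calc _ ≤ ENNReal.ofReal (m ^ (-(q / dualExp p))) * ENNReal.ofReal (C / δ * m) ^ (q / dualExp p) := by
        gcongr
        exact avg_neg hn a hh hκ hm hu
    _ = _ := by
        rw [ENNReal.ofReal_rpow_of_pos (by positivity), ← ENNReal.ofReal_mul (by positivity),
          Real.mul_rpow (by positivity) hm.le, Real.rpow_neg hm.le]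
        congr 1
        field_simp

/-- second family of weights -/
lemma Apq_B (hn : 0 < n) {p q : ℝ} (hp : 1 < p) (hq : 0 < q) : ∃ C : ℝ, 0 < C ∧
    ∀ δ : ℝ, 0 < δ → δ ≤ 1 / 2 →
    Apq p q (fun x : Euc n => ‖x‖ ^ ((δ - n) / q)) ≤ ENNReal.ofReal ((C / δ) ^ (1:ℝ)) := by
  obtain ⟨C, hC, H⟩ := A1 hn
  have hp' : 0 < dualExp p := div_pos (by linarith) (by linarith)
  refine ⟨C, hC, fun δ hδ hδ2 => ?_⟩
  refine iSup_le fun a => iSup_le fun h => iSup_le fun hh => ?_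
  rw [if_neg hp.ne']
  obtain ⟨m, hm, hu, hav⟩ := H δ hδ hδ2 a h hh
  rw [avg_pw hn, avg_pw hn]
  have e1 : (δ - n) / q * q = δ - n := by field_simp
  have e2 : (δ - n) / q * (-dualExp p) = (δ - n) * (-(dualExp p / q)) := by ring
  rw [e1, e2]
  have hκ : 0 < dualExp p / q := by positivity
  calc _ ≤ ENNReal.ofReal (C / δ * m) * ENNReal.ofReal (m ^ (-(dualExp p / q))) ^ (q / dualExp p) := by
        gcongr
        exact avg_neg hn a hh hκ hm hu
    _ = _ := by
        rw [ENNReal.ofReal_rpow_of_pos (by positivity), ← ENNReal.ofReal_mul (by positivity),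
          ← Real.rpow_mul hm.le]
        have : -(dualExp p / q) * (q / dualExp p) = -1 := by field_simp
        rw [this, Real.rpow_neg_one, Real.rpow_one]
        congr 1
        field_simp

lemma wLp_pw (hn : 0 < n) {T : Set (Euc n)} (hT : MeasurableSet T) (a b : ℝ) {p : ℝ} (hp : 0 < p) :
    wLp (fun x : Euc n => ‖x‖ ^ a) (T.indicator fun x => ‖x‖ ^ b) p =
      (∫⁻ x in T, ENNReal.ofReal (‖x‖ ^ ((a + b) * p))) ^ (1 / p) := by
  unfold wLp
  congr 1
  rw [← lintegral_indicator hT]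
  apply lintegral_congr_ae
  filter_upwards [ae_ne_zero hn] with x hx
  have h0 : 0 < ‖x‖ := norm_pos_iff.2 hx
  by_cases h : x ∈ T
  · simp only [indicator_of_mem h]
    rw [abs_of_nonneg (by positivity), ← ENNReal.ofReal_mul (by positivity), ← Real.rpow_add h0,
      ofReal_pw hx]
  · simp [h, hp]

lemma wLpE_ge {T : Set (Euc n)} (hT : MeasurableSet T) (hn : 0 < n) (a b K : ℝ) (hK : 0 < K)
    {q : ℝ} (hq : 0 < q) (g : Euc n → ℝ≥0∞)
    (hg : ∀ x ∈ T, x ≠ 0 → ENNReal.ofReal (K * ‖x‖ ^ b) ≤ g x) :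
    ENNReal.ofReal K * (∫⁻ x in T, ENNReal.ofReal (‖x‖ ^ ((a + b) * q))) ^ (1 / q) ≤
      wLpE (fun x : Euc n => ‖x‖ ^ a) g q := by
  have e : ENNReal.ofReal K = (ENNReal.ofReal K ^ q) ^ (1 / q) := by
    rw [← ENNReal.rpow_mul, mul_one_div_cancel hq.ne', ENNReal.rpow_one]
  rw [e, ← ENNReal.mul_rpow_of_nonneg _ _ (by positivity)]
  unfold wLpE
  gcongr
  rw [← lintegral_const_mul']
  · refine le_trans ?_ (setLIntegral_le_lintegral T _)
    apply setLIntegral_mono_ae' hT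
    filter_upwards [ae_ne_zero hn] with x hx hxT
    have h0 : 0 < ‖x‖ := norm_pos_iff.2 hx
    rw [← ofReal_pw hx, ← ENNReal.mul_rpow_of_nonneg _ _ hq.le]
    refine ENNReal.rpow_le_rpow ?_ hq.le
    calc ENNReal.ofReal K * ENNReal.ofReal (‖x‖ ^ (a + b))
        = ENNReal.ofReal (‖x‖ ^ a) * ENNReal.ofReal (K * ‖x‖ ^ b) := by
          rw [← ENNReal.ofReal_mul (by positivity), ← ENNReal.ofReal_mul (by positivity),
            Real.rpow_add h0]
          congr 1; ring
      _ ≤ ENNReal.ofReal (‖x‖ ^ a) * g x := mul_le_mul_right (hg x hxT hx) _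
  · exact ENNReal.rpow_ne_top_of_nonneg hq.le ENNReal.ofReal_ne_top

lemma riesz_ge {T : Set (Euc n)} (hT : MeasurableSet T) (α β L c : ℝ) (x : Euc n) (hc : 0 ≤ c)
    (e : ℝ) (hL : ∫⁻ y in T, ENNReal.ofReal (‖y‖ ^ e) = ENNReal.ofReal L)
    (hk : ∀ y ∈ T, c * ‖y‖ ^ e ≤ ‖y‖ ^ β * ‖x - y‖ ^ (α - n)) :
    ENNReal.ofReal (c * L) ≤ riesz α (T.indicator fun y => ‖y‖ ^ β) x := by
  unfold riesz
  rw [ENNReal.ofReal_mul hc, ← hL, ← lintegral_const_mul' _ _ ENNReal.ofReal_ne_top]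
  refine le_trans ?_ (setLIntegral_le_lintegral T _)
  apply setLIntegral_mono_ae' hT
  filter_upwards [] with y hy
  rw [indicator_of_mem hy, abs_of_nonneg (by positivity), ← ENNReal.ofReal_mul hc,
    ← ENNReal.ofReal_mul (by positivity)]
  exact ENNReal.ofReal_le_ofReal (hk y hy)

lemma final_contra {A B C D c κ γ s t : ℝ} (hA : 0 < A) (hB : 0 < B) (hC : 0 < C) (hD : 0 < D)
    (hc : 0 < c) (h : κ * γ + t < 1 + s)
    (H : ∀ δ : ℝ, 0 < δ → δ ≤ 1 / 2 → ENNReal.ofReal (A / δ) * ENNReal.ofReal (B / δ) ^ s ≤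
      ENNReal.ofReal c * ENNReal.ofReal ((C / δ) ^ κ) ^ γ * ENNReal.ofReal (D / δ) ^ t) : False := by
  set E := 1 + s - (κ * γ + t) with hE
  have hE0 : 0 < E := by linarith
  set M := A⁻¹ * (B ^ s)⁻¹ * c * C ^ (κ * γ) * D ^ t with hM
  have hM0 : 0 < M := by positivity
  have key : ∀ y : ℝ, 2 ≤ y → y ^ E ≤ M := by
    intro y hy
    have hy0 : 0 < y := by linarith
    have := H y⁻¹ (by positivity) (by rw [one_div]; gcongr)
    simp only [div_inv_eq_mul] at this
    rw [ENNReal.ofReal_rpow_of_pos (by positivity), ENNReal.ofReal_rpow_of_pos (by positivity),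
      ENNReal.ofReal_rpow_of_pos (by positivity), ← ENNReal.ofReal_mul (by positivity),
      ← ENNReal.ofReal_mul (by positivity), ← ENNReal.ofReal_mul (by positivity),
      ENNReal.ofReal_le_ofReal_iff (by positivity), ← Real.rpow_mul (by positivity),
      Real.mul_rpow hB.le hy0.le, Real.mul_rpow hC.le hy0.le, Real.mul_rpow hD.le hy0.le] at this
    rw [hE, Real.rpow_sub hy0, Real.rpow_add hy0, Real.rpow_add hy0, Real.rpow_one, hM,
      div_le_iff₀ (by positivity)]
    calc y * y ^ s = A⁻¹ * (B ^ s)⁻¹ * (A * y * (B ^ s * y ^ s)) := by field_simp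
      _ ≤ A⁻¹ * (B ^ s)⁻¹ * (c * (C ^ (κ * γ) * y ^ (κ * γ)) * (D ^ t * y ^ t)) := by gcongr
      _ = _ := by ring
  have ht := tendsto_rpow_atTop hE0
  obtain ⟨y, hy1, hy2⟩ := ((ht.eventually_gt_atTop M).and (Filter.eventually_ge_atTop 2)).exists
  exact absurd (key y hy2) (not_le.2 hy1)

/-- Sharpness of the exponent `(1-α/n)·max{1, p'/q}` in the strong-type bound
for the Riesz potential (Theorem 2.6, sharpness part). -/
theorem riesz_strong_type_exponent_sharp
    (n : ℕ) (hn : 0 < n) (α p q : ℝ) (hα : 0 < α) (hαn : α < n)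
    (hp : 1 < p) (hpn : p < n / α) (hq : 1 / q = 1 / p - α / n)
    (γ : ℝ) (hγ0 : 0 ≤ γ) (hγ : γ < (1 - α / n) * max 1 (dualExp p / q)) :
    ¬ ∃ c : ℝ, 0 < c ∧ ∀ w f : Euc n → ℝ, Measurable w → (∀ x, 0 ≤ w x) → Measurable f →
      Apq p q w < ⊤ →
      wLpE w (riesz α f) q ≤
        ENNReal.ofReal c * Apq p q w ^ γ * wLp w f p := by
  rintro ⟨c, hc, H⟩
  have hn0 : (0:ℝ) < n := by exact_mod_cast hn
  have hn1 : (1:ℝ) ≤ n := by exact_mod_cast hn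
  have hq0 : 0 < q := by
    have : 0 < 1 / q := by
      rw [hq, sub_pos, div_lt_div_iff₀ hn0 (by linarith)]
      rw [lt_div_iff₀ hα] at hpn
      linarith
    exact one_div_pos.1 this
  have hp0 : 0 < p := by linarith
  have hp' : 0 < dualExp p := div_pos (by linarith) (by linarith)
  have hdual : 1 / dualExp p = 1 - 1 / p := by
    unfold dualExp
    have : p - 1 ≠ 0 := by linarith
    field_simp
  have hαe : α = n - n / q - n / dualExp p := by
    have h1 : (n:ℝ) / q = n * (1 / q) := by ring
    have h2 : (n:ℝ) / dualExp p = n * (1 / dualExp p) := by ring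
    rw [h1, h2, hq, hdual]
    field_simp
    ring
  have hs : 1 - α / n = 1 + 1 / q - 1 / p := by rw [hq]; ring
  have hS := sphS_pos hn
  have hball : MeasurableSet (Metric.ball (0 : Euc n) 1) := measurableSet_ball
  have hmeas : ∀ b : ℝ, Measurable fun x : Euc n => ‖x‖ ^ b := fun b => by fun_prop
  have hker : ∀ x y : Euc n, 1 ≤ ‖x‖ → ‖y‖ < 1 →
      2 ^ (α - n) * ‖x‖ ^ (α - n) ≤ ‖x - y‖ ^ (α - n) := by
    intro x y hx hy
    rw [← Real.mul_rpow (by norm_num) (norm_nonneg _)]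
    apply Real.rpow_le_rpow_of_nonpos
    · have := norm_sub_norm_le x y; linarith
    · have := norm_sub_le x y; linarith
    · linarith
  rcases le_total (dualExp p / q) 1 with hm | hm
  · -- the second family
    rw [max_eq_left hm, mul_one, hs] at hγ
    obtain ⟨C, hC, HA⟩ := Apq_B (n := n) hn hp hq0
    set κ := dualExp p / q with hκd
    have hκ : 0 < κ := by positivity
    have h2 : (0:ℝ) < 2 ^ (α - n) := by positivity
    refine final_contra (A := 2 ^ (α - n) * (sphS n / κ)) (B := sphS n) (C := C)
      (D := sphS n / κ) (c := c) (κ := 1) (γ := γ) (s := 1 / q) (t := 1 / p) (by positivity) hS hC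
      (by positivity) hc (by linarith) ?_
    intro δ hδ hδ2
    set β : ℝ := -n - δ * κ - (α - n) with hβ
    have hrc := radial_compl hn (ε := δ * κ) (by positivity)
    have hrb := radial_ball hn hδ one_pos
    rw [Real.one_rpow, mul_one_div] at hrb
    have hA := HA δ hδ hδ2
    have := H (fun x => ‖x‖ ^ ((δ - n) / q)) ((Metric.ball (0 : Euc n) 1)ᶜ.indicator fun x => ‖x‖ ^ β)
      (hmeas _) (fun x => by positivity) ((hmeas _).indicator hball.compl)
      (hA.trans_lt ENNReal.ofReal_lt_top)
    rw [wLp_pw hn hball.compl _ _ hp0] at this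
    have e1 : ((δ - n) / q + β) * p = -n - δ * κ := by
      have hp1 : p - 1 ≠ 0 := by linarith
      rw [hβ, hαe, hκd, dualExp]
      field_simp
      ring
    rw [e1, hrc] at this
    have e2 : sphS n / (δ * κ) = sphS n / κ / δ := by field_simp
    have hlow := wLpE_ge (n := n) hball hn ((δ - n) / q) 0 (2 ^ (α - n) * (sphS n / (δ * κ)))
      (by positivity) hq0 (riesz α ((Metric.ball (0 : Euc n) 1)ᶜ.indicator fun x => ‖x‖ ^ β)) (by
        intro x hx _
        rw [Real.rpow_zero, mul_one]
        apply riesz_ge hball.compl α β _ _ x h2.le _ hrc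
        intro y hy
        have hy1 : 1 ≤ ‖y‖ := by simpa using hy
        have hy0 : 0 < ‖y‖ := by linarith
        have hk := hker y x hy1 (by simpa using hx)
        rw [norm_sub_rev] at hk
        have : ‖y‖ ^ (-n - δ * κ) = ‖y‖ ^ β * ‖y‖ ^ (α - n) := by
          rw [← Real.rpow_add hy0]; congr 1; rw [hβ]; ring
        rw [this]
        calc _ = ‖y‖ ^ β * (2 ^ (α - n) * ‖y‖ ^ (α - n)) := by ring
          _ ≤ _ := by gcongr)
    have e3 : ((δ - n) / q + 0) * q = δ - n := by field_simp; ring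
    rw [e3, hrb] at hlow
    rw [e2] at hlow this
    rw [mul_div_assoc]
    refine hlow.trans (this.trans ?_)
    gcongr
  · -- the first family
    rw [max_eq_right hm, hs] at hγ
    obtain ⟨C, hC, HA⟩ := Apq_A (n := n) hn hp hq0
    set κ := q / dualExp p with hκd
    have hκ : 0 < κ := by positivity
    have h2 : (0:ℝ) < 2 ^ (α - n) := by positivity
    have hlt : κ * γ < 1 + 1 / q - 1 / p := by
      calc κ * γ < κ * ((1 + 1 / q - 1 / p) * (dualExp p / q)) := by gcongr
        _ = _ := by rw [hκd]; field_simp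
    refine final_contra (A := 2 ^ (α - n) * sphS n) (B := sphS n / κ) (C := C)
      (D := sphS n) (c := c) (κ := κ) (γ := γ) (s := 1 / q) (t := 1 / p) (by positivity)
      (by positivity) hC hS hc (by linarith) ?_
    intro δ hδ hδ2
    have hrc := radial_compl hn (ε := δ * κ) (by positivity)
    have hrb := radial_ball hn hδ one_pos
    rw [Real.one_rpow, mul_one_div] at hrb
    have hA := HA δ hδ hδ2
    have := H (fun x => ‖x‖ ^ ((n - δ) / dualExp p))
      ((Metric.ball (0 : Euc n) 1).indicator fun x => ‖x‖ ^ (δ - n))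
      (hmeas _) (fun x => by positivity) ((hmeas _).indicator hball)
      (hA.trans_lt ENNReal.ofReal_lt_top)
    rw [wLp_pw hn hball _ _ hp0] at this
    have e1 : ((n - δ) / dualExp p + (δ - n)) * p = δ - n := by
      have : (n - δ) / dualExp p = (n - δ) * (1 / dualExp p) := by ring
      rw [this, hdual]; field_simp; ring
    rw [e1, hrb] at this
    have e2 : sphS n / (δ * κ) = sphS n / κ / δ := by field_simp
    have hlow := wLpE_ge (n := n) hball.compl hn ((n - δ) / dualExp p) (α - n)
      (2 ^ (α - n) * (sphS n / δ))
      (by positivity) hq0 (riesz α ((Metric.ball (0 : Euc n) 1).indicator fun x => ‖x‖ ^ (δ - n))) (by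
        intro x hx _
        have e : 2 ^ (α - n) * (sphS n / δ) * ‖x‖ ^ (α - n) =
          (2 ^ (α - n) * ‖x‖ ^ (α - n)) * (sphS n / δ) := by ring
        rw [e]
        apply riesz_ge hball α (δ - n) _ _ x (by positivity) _ hrb
        intro y hy
        have hk := hker x y (by simpa using hx) (by simpa using hy)
        rw [mul_comm]
        gcongr)
    have e3 : ((n - δ) / dualExp p + (α - n)) * q = -n - δ * κ := by
      rw [hαe, hκd]; field_simp; ring
    rw [e3, hrc, e2] at hlow
    rw [mul_div_assoc]
    refine hlow.trans (this.trans ?_)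
    gcongr

end
end
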